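/- Let G be a finite group of order d(d+e), where d is the degree of some irreducible complex character of G and e ≥ 2 is an integer. Then |G| ≤ e⁴ − e³. -/

import Mathlib

open CategoryTheory

/-- `χ : G → ℂ` is the character of an irreducible (simple) finite-dimensional complex
representation of the group `G`. -/
def IsIrrChar (G : Type) [Group G] (χ : G → ℂ) : Prop :=
  ∃ V : FDRep ℂ G, Simple V ∧ FDRep.character V = χ

namespace LargeDegree
open Matrix Finset

section Matrices

variable {ι : Type*} [Fintype ι] [DecidableEq ι]

lemma exists_trace_eq_natCast {P : Matrix ι ι ℂ} (hP : P * P = P) : ∃ k : ℕ, P.trace = k := by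
  have h : IsIdempotentElem (Matrix.toLin' P) := by
    change Matrix.toLin' P * Matrix.toLin' P = Matrix.toLin' P
    rw [Module.End.mul_eq_comp, ← Matrix.toLin'_mul, hP]
  exact ⟨_, by
    rw [← Matrix.trace_toLin'_eq]; exact (LinearMap.IsIdempotentElem.isProj_range _ h).trace⟩

lemma average_mul_self {H : Type*} [Group H] [Fintype H] (N : H →* Matrix ι ι ℂ) :
    (((Fintype.card H : ℂ)⁻¹ • ∑ h, N h) * ((Fintype.card H : ℂ)⁻¹ • ∑ h, N h)) =
      (Fintype.card H : ℂ)⁻¹ • ∑ h, N h := by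
  have h1 : ∀ g, N g * ∑ h, N h = ∑ h, N h := fun g => by
    rw [Finset.mul_sum]
    simp_rw [← map_mul]
    exact Fintype.sum_equiv (Equiv.mulLeft g) _ _ (fun _ => rfl)
  have h0 : (Fintype.card H : ℂ) ≠ 0 := by exact_mod_cast Fintype.card_ne_zero
  rw [Matrix.smul_mul, Matrix.mul_smul, Finset.sum_mul]
  simp_rw [h1]
  rw [Finset.sum_const, Finset.card_univ, ← Nat.cast_smul_eq_nsmul ℂ, inv_smul_smul₀ h0]

lemma exists_sum_trace_eq {H : Type*} [Group H] [Fintype H] (N : H →* Matrix ι ι ℂ) :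
    ∃ k : ℕ, ∑ h, (N h).trace = Fintype.card H * k := by
  obtain ⟨k, hk⟩ := exists_trace_eq_natCast (average_mul_self N)
  have h0 : (Fintype.card H : ℂ) ≠ 0 := by exact_mod_cast Fintype.card_ne_zero
  refine ⟨k, ?_⟩
  rw [← hk, Matrix.trace_smul, Matrix.trace_sum, smul_eq_mul, mul_inv_cancel_left₀ h0]

lemma exists_trace_pow_eq {n : ℕ} (hn : n ≠ 0) {ζ : ℂ} (hζ : IsPrimitiveRoot ζ n)
    {A : Matrix ι ι ℂ} (hA : A ^ n = 1) :
    ∃ m : ℕ → ℕ, ∀ k, (A ^ k).trace = ∑ j ∈ range n, (m j : ℂ) * ζ ^ (j * k) := by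
  have hn0 : (n : ℂ) ≠ 0 := by exact_mod_cast hn
  have hζ0 : ζ ≠ 0 := hζ.ne_zero hn
  let P : ℕ → Matrix ι ι ℂ := fun j => (n : ℂ)⁻¹ • ∑ k ∈ range n, (ζ⁻¹ ^ (j * k)) • A ^ k
  have hcyc : ∀ F : ℕ → Matrix ι ι ℂ, F n = F 0 →
      ∑ k ∈ range n, F (k + 1) = ∑ k ∈ range n, F k := fun F hF => by
    have h1 := Finset.sum_range_succ F n
    have h2 := Finset.sum_range_succ' F n
    rw [h1, hF] at h2
    exact (add_right_cancel h2).symm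
  have hAP : ∀ j, A * P j = ζ ^ j • P j := fun j => by
    have := hcyc (fun k => (ζ⁻¹ ^ (j * k)) • A ^ k) (by
      simp only [hA, pow_zero, mul_zero]
      rw [mul_comm, pow_mul, inv_pow, hζ.pow_eq_one]; simp)
    simp only [P]
    rw [Matrix.mul_smul, smul_comm, Finset.mul_sum, ← this, Finset.smul_sum, Finset.smul_sum,
      Finset.smul_sum]
    refine Finset.sum_congr rfl fun k _ => ?_
    have h1 : ζ ^ j * ζ⁻¹ ^ (j * (k + 1)) = ζ⁻¹ ^ (j * k) := by
      rw [mul_add, pow_add, mul_one, mul_left_comm, ← mul_pow, mul_inv_cancel₀ hζ0, one_pow,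
        mul_one]
    rw [Matrix.mul_smul, ← pow_succ', smul_smul (ζ ^ j), h1]
  have hApP : ∀ k j, A ^ k * P j = ζ ^ (j * k) • P j := fun k j => by
    induction k with
    | zero => simp
    | succ k ih => rw [pow_succ', mul_assoc, ih, Matrix.mul_smul, hAP, smul_smul]; ring_nf
  have hPP : ∀ j, P j * P j = P j := fun j => by
    conv_lhs => enter [1]; simp only [P]
    rw [Matrix.smul_mul, Finset.sum_mul]
    have : ∀ k ∈ range n, ((ζ⁻¹ ^ (j * k)) • A ^ k) * P j = P j := fun k _ => by
      rw [Matrix.smul_mul, hApP, smul_smul, ← mul_pow, inv_mul_cancel₀ hζ0, one_pow, one_smul]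
    rw [Finset.sum_congr rfl this, Finset.sum_const, Finset.card_range,
      ← Nat.cast_smul_eq_nsmul ℂ, inv_smul_smul₀ hn0]
  have hsum : ∑ j ∈ range n, P j = 1 := by
    simp only [P]
    rw [← Finset.smul_sum, Finset.sum_comm]
    have : ∀ k ∈ range n, ∑ j ∈ range n, (ζ⁻¹ ^ (j * k)) • A ^ k =
        if k = 0 then (n : ℂ) • (1 : Matrix ι ι ℂ) else 0 := fun k hk => by
      split_ifs with h
      · subst h
        simp [← Nat.cast_smul_eq_nsmul ℂ]
      · rw [← Finset.sum_smul]
        have h1 : ζ⁻¹ ^ k ≠ 1 := by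
          rw [inv_pow, ne_eq, inv_eq_one]
          exact hζ.pow_ne_one_of_pos_of_lt h (by simpa using hk)
        have h2 : ∑ j ∈ range n, ζ⁻¹ ^ (j * k) = 0 := by
          simp_rw [mul_comm _ k, pow_mul]
          rw [geom_sum_eq h1, ← pow_mul, mul_comm, pow_mul, inv_pow, hζ.pow_eq_one]; simp
        rw [h2, zero_smul]
    rw [Finset.sum_congr rfl this, Finset.sum_ite_eq' (range n) 0 _,
      if_pos (by simpa using Nat.pos_of_ne_zero hn), inv_smul_smul₀ hn0]
  choose m hm using fun j => exists_trace_eq_natCast (hPP j)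
  refine ⟨m, fun k => ?_⟩
  rw [← mul_one (A ^ k), ← hsum, Finset.mul_sum, Matrix.trace_sum]
  refine Finset.sum_congr rfl fun j _ => ?_
  rw [hApP, Matrix.trace_smul, hm, smul_eq_mul, mul_comm]

end Matrices
end LargeDegree

namespace LargeDegree
open Matrix Finset
open scoped Kronecker

section Swap

variable {ι κ : Type*} [Fintype ι] [DecidableEq ι] [Fintype κ] [DecidableEq κ]

/-- The permutation matrix exchanging the two factors of a tensor square. -/
def swapMatrix (ι : Type*) [DecidableEq ι] : Matrix (ι × ι) (ι × ι) ℂ :=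
  fun p q => if p = q.swap then 1 else 0

lemma swapMatrix_mul_self : swapMatrix ι * swapMatrix ι = 1 := by
  ext p q
  simp [swapMatrix, Matrix.mul_apply, Matrix.one_apply]

lemma swapMatrix_mul_kronecker (A : Matrix ι ι ℂ) :
    swapMatrix ι * (A ⊗ₖ A) = (A ⊗ₖ A) * swapMatrix ι := by
  ext p q
  have h : ∀ x : ι × ι, p = x.swap ↔ x = p.swap := fun x =>
    ⟨fun h => by rw [h, Prod.swap_swap], fun h => by rw [h, Prod.swap_swap]⟩
  simp [swapMatrix, Matrix.mul_apply, h, mul_comm]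

lemma trace_kronecker_mul_swapMatrix (A : Matrix ι ι ℂ) :
    ((A ⊗ₖ A) * swapMatrix ι).trace = (A ^ 2).trace := by
  simp [swapMatrix, Matrix.mul_apply, Matrix.trace, pow_two, Fintype.sum_prod_type]

lemma exists_sum_trace_swap_eq {G : Type*} [Group G] [Fintype G] (M : G →* Matrix ι ι ℂ)
    (N : G →* Matrix κ κ ℂ) : ∃ a b : ℕ,
      ∑ g, (M g).trace ^ 2 * (N g).trace = Fintype.card G * ((a : ℂ) + b) ∧
      ∑ g, (M (g ^ 2)).trace * (N g).trace = Fintype.card G * ((a : ℂ) - b) := by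
  let T : G →* Matrix ((ι × ι) × κ) ((ι × ι) × κ) ℂ :=
    { toFun := fun g => (M g ⊗ₖ M g) ⊗ₖ N g
      map_one' := by simp
      map_mul' := fun g h => by simp only [map_mul, Matrix.mul_kronecker_mul] }
  have h0 : (Fintype.card G : ℂ) ≠ 0 := by exact_mod_cast Fintype.card_ne_zero
  let S : Matrix ((ι × ι) × κ) ((ι × ι) × κ) ℂ := swapMatrix ι ⊗ₖ 1
  let E := (Fintype.card G : ℂ)⁻¹ • ∑ g, T g
  have hS : S * S = 1 := by
    simp only [S, ← Matrix.mul_kronecker_mul, swapMatrix_mul_self, mul_one, one_kronecker_one]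
  have hST : ∀ g, S * T g = T g * S := fun g => by
    simp only [S, T, MonoidHom.coe_mk, OneHom.coe_mk, ← Matrix.mul_kronecker_mul,
      swapMatrix_mul_kronecker, mul_one, one_mul]
  have hSE : S * E = E * S := by
    simp only [E, Matrix.mul_smul, Matrix.smul_mul, Finset.mul_sum, Finset.sum_mul, hST]
  have hE : E * E = E := average_mul_self T
  have key : ∀ s : ℂ, s * s = 1 → ((2 : ℂ)⁻¹ • (E + s • (E * S))) *
      ((2 : ℂ)⁻¹ • (E + s • (E * S))) = (2 : ℂ)⁻¹ • (E + s • (E * S)) := fun s hs => by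
    have h1 : E * (E * S) = E * S := by rw [← mul_assoc, hE]
    have h2 : E * S * E = E * S := by rw [mul_assoc, hSE, h1]
    have h3 : E * S * (E * S) = E := by rw [← mul_assoc, h2, mul_assoc, hS, mul_one]
    simp only [Matrix.smul_mul, Matrix.mul_smul, add_mul, mul_add, h1, h2, h3, hE, smul_smul]
    rcases mul_self_eq_one_iff.mp hs with rfl | rfl <;> module
  obtain ⟨a, ha⟩ := exists_trace_eq_natCast (key 1 (by norm_num))
  obtain ⟨b, hb⟩ := exists_trace_eq_natCast (key (-1) (by norm_num))
  have t1 : E.trace = (Fintype.card G : ℂ)⁻¹ * ∑ g, (M g).trace ^ 2 * (N g).trace := by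
    simp only [E, T, Matrix.trace_smul, Matrix.trace_sum, MonoidHom.coe_mk, OneHom.coe_mk,
      Matrix.trace_kronecker, smul_eq_mul, pow_two]
  have t2 : (E * S).trace =
      (Fintype.card G : ℂ)⁻¹ * ∑ g, (M (g ^ 2)).trace * (N g).trace := by
    simp only [E, T, S, Matrix.smul_mul, Finset.sum_mul, Matrix.trace_smul, Matrix.trace_sum,
      MonoidHom.coe_mk, OneHom.coe_mk, ← Matrix.mul_kronecker_mul, mul_one,
      Matrix.trace_kronecker, trace_kronecker_mul_swapMatrix, smul_eq_mul, map_pow]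
  simp only [Matrix.trace_smul, Matrix.trace_add, smul_eq_mul] at ha hb
  refine ⟨a, b, ?_, ?_⟩
  · rw [← mul_inv_cancel_left₀ h0 (∑ g, (M g).trace ^ 2 * (N g).trace), ← t1, ← ha, ← hb]
    ring
  · rw [← mul_inv_cancel_left₀ h0 (∑ g, (M (g ^ 2)).trace * (N g).trace), ← t2, ← ha, ← hb]
    ring

end Swap
end LargeDegree

namespace LargeDegree
open Matrix Finset

section Schur

variable {G : Type*} [Group G] [Fintype G] {ι : Type*} [Fintype ι] [DecidableEq ι]

lemma exists_sum_smul_eq {M : G →* Matrix ι ι ℂ}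
    (hM : ∀ A, (∀ g, M g * A = A * M g) → ∃ c : ℂ, A = c • 1)
    {c : G → ℂ} (hc : ∀ x y, c (x * y) = c (y * x)) :
    ∃ w : ℂ, ∑ x, c x • M x = w • 1 := by
  refine hM _ fun g => ?_
  rw [Finset.mul_sum, Finset.sum_mul]
  refine Fintype.sum_equiv (MulAut.conj g).toEquiv _ _ fun x => ?_
  have h1 : c (g * x * g⁻¹) = c x := by rw [hc, ← mul_assoc, inv_mul_cancel, one_mul]
  rw [Matrix.mul_smul, ← map_mul]
  change _ = c (g * x * g⁻¹) • M (g * x * g⁻¹) * M g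
  rw [h1, Matrix.smul_mul, ← map_mul, inv_mul_cancel_right]

lemma card_mul_sum_trace_mul {M : G →* Matrix ι ι ℂ}
    (hM : ∀ A, (∀ g, M g * A = A * M g) → ∃ c : ℂ, A = c • 1)
    {c : G → ℂ} (hc : ∀ x y, c (x * y) = c (y * x)) (g : G) :
    (Fintype.card ι : ℂ) * ∑ x, c x * (M (x * g)).trace =
      (∑ x, c x * (M x).trace) * (M g).trace := by
  obtain ⟨w, hw⟩ := exists_sum_smul_eq hM hc
  have h1 := congrArg Matrix.trace hw
  have h2 := congrArg (fun A => (A * M g).trace) hw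
  simp only [Matrix.trace_sum, Matrix.trace_smul, Matrix.trace_one, smul_eq_mul,
    Finset.sum_mul, Matrix.smul_mul, ← map_mul, one_mul] at h1 h2
  rw [h1, h2]
  ring

lemma exists_isIntegral_sum_trace {M : G →* Matrix ι ι ℂ} [Nonempty ι]
    (hM : ∀ A, (∀ g, M g * A = A * M g) → ∃ c : ℂ, A = c • 1)
    {c : G → ℤ} (hc : ∀ x y, c (x * y) = c (y * x)) :
    ∃ w : ℂ, IsIntegral ℤ w ∧ ∑ x, (c x : ℂ) * (M x).trace = Fintype.card ι * w := by
  obtain ⟨w, hw⟩ := exists_sum_smul_eq hM (c := fun x => (c x : ℂ)) (fun x y => by simp [hc x y])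
  refine ⟨w, ?_, ?_⟩
  · have h1 : IsIntegral ℤ (∑ x, c x • MonoidAlgebra.of ℤ G x) := Algebra.IsIntegral.isIntegral _
    have h2 := h1.map (MonoidAlgebra.lift ℤ (Matrix ι ι ℂ) G M)
    have h3 : MonoidAlgebra.lift ℤ (Matrix ι ι ℂ) G M (∑ x, c x • MonoidAlgebra.of ℤ G x) =
        algebraMap ℂ (Matrix ι ι ℂ) w := by
      rw [Algebra.algebraMap_eq_smul_one, ← hw, map_sum]
      refine Finset.sum_congr rfl fun x _ => ?_
      rw [map_zsmul, MonoidAlgebra.lift_of, Int.cast_smul_eq_zsmul]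
    rw [h3] at h2
    exact (isIntegral_algebraMap_iff (algebraMap ℂ (Matrix ι ι ℂ)).injective).mp h2
  · have h1 := congrArg Matrix.trace hw
    simpa only [Matrix.trace_sum, Matrix.trace_smul, Matrix.trace_one, smul_eq_mul,
      mul_comm w] using h1

end Schur

lemma exists_int_of_isIntegral {w : ℂ} (hw : IsIntegral ℤ w) {a d : ℤ} (hd : d ≠ 0)
    (h : (a : ℂ) = d * w) : d ∣ a := by
  have hd' : (d : ℂ) ≠ 0 := by exact_mod_cast hd
  have hq : w = algebraMap ℚ ℂ (a / d : ℚ) := by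
    rw [eq_comm] at h
    simp [← h]
    field_simp
  rw [hq] at hw
  have h2 := (isIntegral_algebraMap_iff (algebraMap ℚ ℂ).injective).mp hw
  obtain ⟨k, hk⟩ := IsIntegrallyClosed.isIntegral_iff.mp h2
  refine ⟨k, ?_⟩
  have hd2 : (d : ℚ) ≠ 0 := by exact_mod_cast hd
  have : (a : ℚ) = d * k := by
    rw [← eq_intCast (algebraMap ℤ ℚ) k, hk]
    field_simp
  exact_mod_cast this

end LargeDegree

namespace LargeDegree
open Finset

section Rationality

variable {G : Type*} [Group G] [Fintype G] {ι : Type*} [Fintype ι] [DecidableEq ι]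

lemma eq_trace_of_convolution {M : G →* Matrix ι ι ℂ}
    (hM : ∀ A, (∀ g, M g * A = A * M g) → ∃ c : ℂ, A = c • 1) {φ ψ : G → ℂ}
    (hψ : ∀ x, (M x).trace = ψ x) (hψinv : ∀ x, ψ x⁻¹ = star (ψ x))
    (hψnorm : ∑ x, ψ x⁻¹ * ψ x = Fintype.card G)
    (hφinv : ∀ x, φ x⁻¹ = star (φ x)) (hφ1 : φ 1 = Fintype.card ι)
    (hφconj : ∀ x y, φ (x * y) = φ (y * x)) (hφnorm : ∑ x, φ x⁻¹ * φ x = Fintype.card G)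
    (hφmul : ∀ g, (Fintype.card ι : ℂ) * ∑ x, φ x⁻¹ * φ (x * g) = Fintype.card G * φ g)
    (hlt : Fintype.card G < 2 * Fintype.card ι ^ 2) (g : G) : φ g = ψ g := by
  set n := Fintype.card G with hn
  have hψ1 : ψ 1 = Fintype.card ι := by rw [← hψ]; simp
  set W := ∑ x, φ x⁻¹ * ψ x with hW
  have hφψ : ∀ g, (Fintype.card ι : ℂ) * ∑ x, φ x⁻¹ * ψ (x * g) = W * ψ g := fun g => by
    have := card_mul_sum_trace_mul hM (c := fun x => φ x⁻¹) (fun x y => by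
      rw [mul_inv_rev, mul_inv_rev, hφconj]) g
    simpa only [hψ] using this
  have hWW : W * W = n * W := by
    have h1 : (Fintype.card ι : ℂ) * (∑ x, φ x⁻¹ * ∑ y, φ y⁻¹ * ψ (y * x)) = W * W := by
      rw [Finset.mul_sum]
      simp_rw [mul_left_comm (Fintype.card ι : ℂ), hφψ, mul_left_comm _ W]
      rw [← Finset.mul_sum]
    have h2 : (Fintype.card ι : ℂ) * (∑ x, φ x⁻¹ * ∑ y, φ y⁻¹ * ψ (y * x)) = n * W := by
      have h3 : ∀ x, ∑ y, φ y⁻¹ * ψ (y * x) = ∑ y, φ (x * y⁻¹) * ψ y := fun x =>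
        Fintype.sum_equiv (Equiv.mulRight x) _ _ fun y => by simp
      simp_rw [h3, Finset.mul_sum]
      rw [Finset.sum_comm]
      rw [hW, Finset.mul_sum]
      refine Finset.sum_congr rfl fun y _ => ?_
      rw [← mul_assoc, ← hφmul, Finset.mul_sum, Finset.sum_mul]
      exact Finset.sum_congr rfl fun x _ => by ring
    rw [← h1, h2]
  have hW' : ∑ x, ψ x⁻¹ * φ x = W :=
    Fintype.sum_equiv (Equiv.inv G) _ _ fun x => by
      simp only [Equiv.inv_apply, inv_inv]; exact mul_comm _ _
  have hexp : ∀ s : ℂ, s * s = 1 → star s = s →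
      ((∑ x, Complex.normSq (φ x + s * ψ x) : ℝ) : ℂ) = 2 * n + 2 * s * W := fun s hs hs' => by
    push_cast
    have h1 : ∀ x, (Complex.normSq (φ x + s * ψ x) : ℂ) = φ x⁻¹ * φ x + s * (φ x⁻¹ * ψ x) +
        s * (ψ x⁻¹ * φ x) + ψ x⁻¹ * ψ x := fun x => by
      rw [← Complex.mul_conj, starRingEnd_apply, star_add, star_mul', hs', ← hφinv, ← hψinv]
      linear_combination (ψ x * ψ x⁻¹) * hs
    simp_rw [h1, Finset.sum_add_distrib, ← Finset.mul_sum]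
    rw [hφnorm, hψnorm, hW', ← hW]
    ring
  have hcases : W = 0 ∨ W = n := by
    by_cases h : W = 0
    · exact Or.inl h
    · exact Or.inr (mul_right_cancel₀ h hWW)
  rcases hcases with h | h
  · exfalso
    have h1 := hexp 1 (by norm_num) (by simp)
    rw [h] at h1
    have h2 : ∑ x, Complex.normSq (φ x + 1 * ψ x) = 2 * n := by
      have : ((∑ x, Complex.normSq (φ x + 1 * ψ x) : ℝ) : ℂ) = ((2 * n : ℝ) : ℂ) := by
        rw [h1]; push_cast; ring
      exact_mod_cast this
    have h3 : Complex.normSq (φ 1 + 1 * ψ 1) ≤ ∑ x, Complex.normSq (φ x + 1 * ψ x) :=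
      Finset.single_le_sum (f := fun x => Complex.normSq (φ x + 1 * ψ x))
        (fun x _ => Complex.normSq_nonneg _) (Finset.mem_univ 1)
    rw [h2, hφ1, hψ1, one_mul, ← Nat.cast_add, Complex.normSq_natCast] at h3
    have h4 : (Fintype.card ι + Fintype.card ι) * (Fintype.card ι + Fintype.card ι) ≤ 2 * n := by
      exact_mod_cast h3
    nlinarith
  · have h1 := hexp (-1) (by norm_num) (by simp)
    rw [h] at h1
    have h2 : ∑ x, Complex.normSq (φ x + -1 * ψ x) = 0 := by
      have : ((∑ x, Complex.normSq (φ x + -1 * ψ x) : ℝ) : ℂ) = ((0 : ℝ) : ℂ) := by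
        rw [h1]; push_cast; ring
      exact_mod_cast this
    rw [Finset.sum_eq_zero_iff_of_nonneg (fun x _ => Complex.normSq_nonneg _)] at h2
    have h3 := Complex.normSq_eq_zero.mp (h2 g (Finset.mem_univ g))
    linear_combination h3

/-- A character which is large compared with the group order has integral values, and is therefore
invariant under inversion. -/
lemma exists_int_trace {M : G →* Matrix ι ι ℂ} [Nonempty ι]
    (hM : ∀ A, (∀ g, M g * A = A * M g) → ∃ c : ℂ, A = c • 1)
    (hnorm : ∑ g, (M g).trace * (M g⁻¹).trace = Fintype.card G)
    (hlt : Fintype.card G < 2 * Fintype.card ι ^ 2) (g : G) :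
    ∃ k : ℤ, (M g).trace = k ∧ (M g⁻¹).trace = k := by
  set n := Fintype.card G with hn
  have hn0 : n ≠ 0 := Fintype.card_ne_zero
  have hnC : (n : ℂ) ≠ 0 := by exact_mod_cast hn0
  have hd0 : (Fintype.card ι : ℂ) ≠ 0 := by exact_mod_cast Fintype.card_ne_zero
  set ζ : ℂ := Complex.exp (2 * Real.pi * Complex.I / n) with hζdef
  have hζ : IsPrimitiveRoot ζ n := Complex.isPrimitiveRoot_exp n hn0
  have hpow : ∀ g : G, M g ^ n = 1 := fun g => by rw [← map_pow, hn, pow_card_eq_one, map_one]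
  choose m hm using fun g => exists_trace_pow_eq hn0 hζ (hpow g)
  let K := algebraicClosure ℚ ℂ
  have hζint : IsIntegral ℤ ζ := hζ.isIntegral (Nat.pos_of_ne_zero hn0)
  have : IsAlgClosure ℚ K := algebraicClosure.isAlgClosure ℚ ℂ
  have : IsGalois ℚ K := IsAlgClosure.isGalois ℚ K
  let z : K := ⟨ζ, mem_algebraicClosure_iff.mpr (hζint.tower_top (A := ℚ)).isAlgebraic⟩
  have hz : z ^ n = 1 := Subtype.ext (by simpa [z] using hζ.pow_eq_one)
  let χ : G → K := fun g => ∑ j ∈ range n, (m g j : K) * z ^ j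
  have hχ : ∀ g, (χ g : ℂ) = (M g).trace := fun g => by
    have := hm g 1
    simp only [pow_one, mul_one] at this
    rw [this]
    simp [χ, z]
  have hχinv : ∀ g, χ g⁻¹ = ∑ j ∈ range n, (m g j : K) * (z ^ (n - 1)) ^ j := fun g => by
    apply Subtype.ext
    have h1 : g⁻¹ = g ^ (n - 1) := by
      rw [inv_eq_iff_mul_eq_one, ← pow_succ', Nat.sub_add_cancel (Nat.pos_of_ne_zero hn0), hn,
        pow_card_eq_one]
    rw [hχ, h1, map_pow, hm]
    simp [z, ← pow_mul, mul_comm]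
  have hχconj : ∀ x y, χ (x * y) = χ (y * x) := fun x y => by
    apply Subtype.ext
    rw [hχ, hχ, map_mul, map_mul, Matrix.trace_mul_comm]
  have hχ1 : χ 1 = Fintype.card ι := Subtype.ext (by rw [hχ]; simp)
  have hχnorm : ∑ x, χ x⁻¹ * χ x = n := by
    apply Subtype.ext
    push_cast
    simp only [hχ, mul_comm (M _⁻¹).trace]
    exact hnorm
  have hχmul : ∀ g, (Fintype.card ι : K) * ∑ x, χ x⁻¹ * χ (x * g) = n * χ g := fun g => by
    have := card_mul_sum_trace_mul hM (c := fun x => (χ x⁻¹ : ℂ)) (fun x y => by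
      rw [mul_inv_rev, mul_inv_rev, hχconj]) g
    apply Subtype.ext
    push_cast
    have h2 : ∑ x, (χ x⁻¹ : ℂ) * (χ x : ℂ) = n := by exact_mod_cast congrArg Subtype.val hχnorm
    simp only [hχ] at this h2 ⊢
    rw [this, h2]
  have hfix : ∀ (σ : K ≃ₐ[ℚ] K) (g : G), σ (χ g) = χ g := fun σ => by
    let φ : G → ℂ := fun g => σ (χ g)
    let ψ : G → ℂ := fun g => χ g
    have hstar : ∀ w : K, w ^ n = 1 → star (w : ℂ) = (w : ℂ) ^ (n - 1) := fun w hw => by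
      have hw' : (w : ℂ) ^ n = 1 := by exact_mod_cast congrArg Subtype.val hw
      have h1 : (w : ℂ)⁻¹ = (w : ℂ) ^ (n - 1) := by
        rw [inv_eq_iff_eq_inv, eq_comm]
        apply inv_eq_of_mul_eq_one_left
        rw [← pow_succ', Nat.sub_add_cancel (Nat.pos_of_ne_zero hn0), hw']
      rw [← h1, Complex.inv_eq_conj (Complex.norm_eq_one_of_pow_eq_one hw' hn0)]
      rfl
    have hφinv : ∀ g, φ g⁻¹ = star (φ g) := fun g => by
      simp only [φ]
      rw [hχinv]
      simp only [χ, map_sum, map_mul, map_natCast, map_pow]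
      push_cast
      rw [star_sum]
      refine Finset.sum_congr rfl fun j _ => ?_
      rw [star_mul', star_pow, hstar (σ z) (by rw [← map_pow, hz, map_one]), star_natCast]
    have hψinv : ∀ g, ψ g⁻¹ = star (ψ g) := fun g => by
      simp only [ψ]
      rw [hχinv]
      simp only [χ]
      push_cast
      rw [star_sum]
      refine Finset.sum_congr rfl fun j _ => ?_
      rw [star_mul', star_pow, hstar z hz, star_natCast]
    have hφ1 : φ 1 = Fintype.card ι := by simp [φ, hχ1]
    have hφconj : ∀ x y, φ (x * y) = φ (y * x) := fun x y => by simp only [φ, hχconj x y]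
    have hφnorm : ∑ x, φ x⁻¹ * φ x = n := by
      have := congrArg (fun w => (σ w : ℂ)) hχnorm
      simpa [φ] using this
    have hψnorm : ∑ x, ψ x⁻¹ * ψ x = n := by
      have := congrArg (fun w : K => (w : ℂ)) hχnorm
      simpa [ψ] using this
    have hφmul : ∀ g, (Fintype.card ι : ℂ) * ∑ x, φ x⁻¹ * φ (x * g) = n * φ g := fun g => by
      have := congrArg (fun w => (σ w : ℂ)) (hχmul g)
      simpa [φ] using this
    exact fun g => Subtype.ext (eq_trace_of_convolution hM (fun x => (hχ x).symm) hψinv hψnorm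
      hφinv hφ1 hφconj hφnorm hφmul hlt g)
  have hinv : ∀ g, ∃ k : ℤ, (M g).trace = k := fun g => by
    obtain ⟨r, hr⟩ := (InfiniteGalois.mem_range_algebraMap_iff_fixed (k := ℚ) (χ g)).mpr
      fun σ => hfix σ g
    have h1 : (M g).trace = algebraMap ℚ ℂ r := by
      rw [← hχ, ← hr]; rfl
    have h2 : IsIntegral ℤ (M g).trace := by
      have := hm g 1
      rw [pow_one] at this
      rw [this]
      refine IsIntegral.sum _ fun j _ => IsIntegral.mul ?_ (hζint.pow _)
      exact_mod_cast isIntegral_algebraMap (R := ℤ) (A := ℂ) (x := (m g j : ℤ))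
    rw [h1] at h2
    obtain ⟨k, hk⟩ := IsIntegrallyClosed.isIntegral_iff.mp
      ((isIntegral_algebraMap_iff (algebraMap ℚ ℂ).injective).mp h2)
    exact ⟨k, by rw [h1, ← hk]; simp⟩
  obtain ⟨k, hk⟩ := hinv g
  refine ⟨k, hk, ?_⟩
  have h1 : (M g⁻¹).trace = star (M g).trace := by
    rw [← hχ, hχinv, ← hχ]
    simp only [χ]
    push_cast
    rw [star_sum]
    refine Finset.sum_congr rfl fun j _ => ?_
    have hw : ζ⁻¹ = ζ ^ (n - 1) := by
      rw [inv_eq_iff_eq_inv, eq_comm]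
      apply inv_eq_of_mul_eq_one_left
      rw [← pow_succ', Nat.sub_add_cancel (Nat.pos_of_ne_zero hn0), hζ.pow_eq_one]
    have hs : star ζ = ζ ^ (n - 1) := by
      rw [← hw, Complex.inv_eq_conj (Complex.norm_eq_one_of_pow_eq_one hζ.pow_eq_one hn0)]
      rfl
    rw [star_mul', star_pow, star_natCast]
    simp only [z, hs]
  rw [h1, hk, star_intCast]

end Rationality
end LargeDegree

namespace LargeDegree
open Finset

/-- The properties of an irreducible character `f` of degree `d` with values in `ℤ` which are used
in the bound. -/
structure IsIntChar (G : Type*) [Group G] [Fintype G] (d : ℕ) (f : G → ℤ) : Prop where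
  map_one : f 1 = d
  map_mul_comm : ∀ x y, f (x * y) = f (y * x)
  map_inv : ∀ x, f x⁻¹ = f x
  sum_mul_map_mul : ∀ c : G → ℤ, (∀ x y, c (x * y) = c (y * x)) → ∀ g,
    d * ∑ x, c x * f (x * g) = (∑ x, c x * f x) * f g
  dvd_sum : ∀ c : G → ℤ, (∀ x y, c (x * y) = c (y * x)) → (d : ℤ) ∣ ∑ x, c x * f x
  sum_sq : ∑ x, f x ^ 2 = Fintype.card G
  sum_cube : ∃ a b : ℕ, ∑ x, f x ^ 3 = Fintype.card G * ((a : ℤ) + b) ∧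
    ∑ x, f (x ^ 2) * f x = Fintype.card G * ((a : ℤ) - b)
  sum_map_sq : ∑ x, f (x ^ 2) = Fintype.card G ∨ ∑ x, f (x ^ 2) = -Fintype.card G
  card_dvd_sum : ∀ (H : Subgroup G) (s : Finset G), (∀ x, x ∈ s ↔ x ∈ H) →
    (s.card : ℤ) ∣ ∑ x ∈ s, f x

lemma exists_isIntChar_of_matrix {G : Type*} [Group G] [Fintype G] {ι : Type*} [Fintype ι]
    [DecidableEq ι] [Nonempty ι] {M : G →* Matrix ι ι ℂ}
    (hM : ∀ A, (∀ g, M g * A = A * M g) → ∃ c : ℂ, A = c • 1)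
    (hnorm : ∑ g, (M g).trace * (M g⁻¹).trace = Fintype.card G)
    (hlt : Fintype.card G < 2 * Fintype.card ι ^ 2) :
    ∃ f : G → ℤ, IsIntChar G (Fintype.card ι) f := by
  choose f hf hfi using fun g => exists_int_trace hM hnorm hlt g
  have hd0 : (Fintype.card ι : ℤ) ≠ 0 := by exact_mod_cast Fintype.card_ne_zero
  have hG0 : (Fintype.card G : ℤ) ≠ 0 := by exact_mod_cast Fintype.card_ne_zero
  have hsq : ∑ x, f x ^ 2 = (Fintype.card G : ℤ) := by
    simp_rw [hfi, hf] at hnorm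
    simp only [pow_two]
    exact_mod_cast hnorm
  refine ⟨f, ?_, ?_, ?_, ?_, ?_, hsq, ?_, ?_, ?_⟩
  · have := hf 1
    rw [map_one, Matrix.trace_one] at this
    exact_mod_cast this.symm
  · intro x y
    have := Matrix.trace_mul_comm (M x) (M y)
    rw [← map_mul, ← map_mul, hf, hf] at this
    exact_mod_cast this
  · intro x
    have := (hf x⁻¹).symm.trans (hfi x)
    exact_mod_cast this
  · intro c hc g
    have := card_mul_sum_trace_mul hM (c := fun x => (c x : ℂ)) (fun x y => by simp [hc x y]) g
    simp only [hf] at this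
    exact_mod_cast this
  · intro c hc
    obtain ⟨w, hw, h⟩ := exists_isIntegral_sum_trace hM hc
    refine exists_int_of_isIntegral hw hd0 ?_
    simp only [hf] at h
    exact_mod_cast h
  · obtain ⟨a, b, h1, h2⟩ := exists_sum_trace_swap_eq M M
    refine ⟨a, b, ?_, ?_⟩
    · simp only [hf, ← pow_succ] at h1
      exact_mod_cast h1
    · simp only [hf] at h2
      exact_mod_cast h2
  · obtain ⟨a, b, h1, h2⟩ := exists_sum_trace_swap_eq M (1 : G →* Matrix (Fin 1) (Fin 1) ℂ)
    simp only [hf, MonoidHom.one_apply, Matrix.trace_one, Fintype.card_fin, Nat.cast_one,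
      mul_one] at h1 h2
    have h1' : ∑ x, f x ^ 2 = Fintype.card G * ((a : ℤ) + b) := by exact_mod_cast h1
    have h2' : ∑ x, f (x ^ 2) = Fintype.card G * ((a : ℤ) - b) := by exact_mod_cast h2
    rw [hsq] at h1'
    have h3 : (a : ℤ) + b = 1 := by
      have := mul_left_cancel₀ hG0 ((mul_one (Fintype.card G : ℤ)).trans h1')
      exact this.symm
    rw [h2']
    have h4 : (a = 1 ∧ b = 0) ∨ (a = 0 ∧ b = 1) := by omega
    rcases h4 with ⟨rfl, rfl⟩ | ⟨rfl, rfl⟩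
    · left; simp
    · right; simp
  · intro H s hs
    classical
    obtain ⟨k, hk⟩ := exists_sum_trace_eq (M.comp H.subtype)
    refine ⟨k, ?_⟩
    have h1 : ∑ x ∈ s, f x = ∑ x : H, f x := Finset.sum_subtype s hs f
    have h2 : s.card = Fintype.card H := (Fintype.card_of_subtype s hs).symm
    simp only [MonoidHom.comp_apply, Subgroup.coe_subtype, hf] at hk
    rw [h1, h2]
    exact_mod_cast hk

lemma exists_isIntChar {G : Type} [Group G] [Fintype G] {d : ℕ} {χ : G → ℂ}
    (hχ : IsIrrChar G χ) (hd : χ 1 = d) (hlt : Fintype.card G < 2 * d ^ 2) :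
    ∃ f : G → ℤ, IsIntChar G d f := by
  obtain ⟨V, hV, rfl⟩ := hχ
  rw [FDRep.char_one] at hd
  have hd' : Module.finrank ℂ V = d := by exact_mod_cast hd
  have hd0 : d ≠ 0 := by
    rintro rfl
    simp at hlt
  let b := Module.finBasisOfFinrankEq ℂ V hd'
  let Φ := LinearMap.toMatrixAlgEquiv b
  let M : G →* Matrix (Fin d) (Fin d) ℂ := (Φ : _ →* _).comp V.ρ
  have hMa : ∀ g, M g = Φ (V.ρ g) := fun g => rfl
  have htr : ∀ g, (M g).trace = V.character g := fun g => by
    rw [hMa, FDRep.character]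
    exact (LinearMap.trace_eq_matrix_trace ℂ b (V.ρ g)).symm
  have : NeZero d := ⟨hd0⟩
  have hM : ∀ A, (∀ g, M g * A = A * M g) → ∃ c : ℂ, A = c • 1 := fun A hA => by
    have h1 : ∀ g, V.ρ g * Φ.symm A = Φ.symm A * V.ρ g := fun g => by
      apply Φ.injective
      rw [map_mul, map_mul, AlgEquiv.apply_symm_apply]
      exact hA g
    let F : V ⟶ V := ⟨FGModuleCat.ofHom (Φ.symm A), fun g => by
      ext v
      exact congrArg (fun T : V →ₗ[ℂ] V => T v) (h1 g).symm⟩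
    obtain ⟨c, hc⟩ := endomorphism_simple_eq_smul_id ℂ F
    refine ⟨c, ?_⟩
    have h2 : Φ.symm A = c • 1 := by
      have := congrArg (fun T : V ⟶ V => T.hom.hom.hom) hc
      exact this.symm
    rw [← Φ.apply_symm_apply A, h2, map_smul, map_one]
  have hnorm : ∑ g, (M g).trace * (M g⁻¹).trace = Fintype.card G := by
    simp only [htr]
    have h0 : (Nat.card G : ℂ) ≠ 0 := by exact_mod_cast Nat.card_pos.ne'
    have : Invertible (Nat.card G : ℂ) := invertibleOfNonzero h0
    have h := FDRep.char_orthonormal V V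
    rw [if_pos ⟨Iso.refl V⟩, inv_mul_eq_one₀ h0, Nat.card_eq_fintype_card] at h
    exact h.symm
  simpa using exists_isIntChar_of_matrix hM hnorm (by simpa using hlt)

end LargeDegree

namespace LargeDegree
open Finset

/-- The sum of a function which is invariant under a group acting freely on its support is divisible
by the order of the group. -/
lemma card_dvd_sum_of_invariant {P α : Type*} [Group P] [Fintype P] (φ : P →* Equiv.Perm α)
    (s : Finset α) (hs : ∀ (p : P) (a : α), a ∈ s → φ p a ∈ s) {F : α → ℤ}
    (hF : ∀ (p : P) (a : α), a ∈ s → F (φ p a) = F a)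
    (hfree : ∀ a ∈ s, F a ≠ 0 → ∀ p : P, φ p a = a → p = 1) :
    (Fintype.card P : ℤ) ∣ ∑ a ∈ s, F a := by
  classical
  let _ : MulAction P α := MulAction.compHom α φ
  have hφ : ∀ (p : P) (a : α), p • a = φ p a := fun _ _ => rfl
  simp only [← hφ] at hs hF hfree
  rw [← Finset.sum_fiberwise_of_maps_to (s := s) (t := s.image (fun a => MulAction.orbit P a))
    (g := fun a => MulAction.orbit P a) (fun a ha => Finset.mem_image_of_mem _ ha)]
  refine Finset.dvd_sum fun O hO => ?_
  obtain ⟨a, ha, rfl⟩ := Finset.mem_image.mp hO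
  have h1 : (s.filter fun b => MulAction.orbit P b = MulAction.orbit P a) =
      univ.image (fun p : P => p • a) := by
    ext b
    simp only [mem_filter, mem_image, mem_univ, true_and, MulAction.orbit_eq_iff]
    constructor
    · rintro ⟨-, p, rfl⟩
      exact ⟨p, rfl⟩
    · rintro ⟨p, rfl⟩
      exact ⟨hs p a ha, p, rfl⟩
  have h2 : ∑ b ∈ s.filter (fun b => MulAction.orbit P b = MulAction.orbit P a), F b =
      ∑ b ∈ s.filter (fun b => MulAction.orbit P b = MulAction.orbit P a), F a := by
    refine Finset.sum_congr rfl fun b hb => ?_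
    rw [h1] at hb
    obtain ⟨p, -, rfl⟩ := Finset.mem_image.mp hb
    exact hF p a ha
  rw [h2, Finset.sum_const]
  by_cases h0 : F a = 0
  · simp [h0]
  · rw [h1, Finset.card_image_of_injective, Finset.card_univ, nsmul_eq_mul]
    · exact dvd_mul_right _ _
    · intro p r hpr
      have h3 : (r⁻¹ * p) • a = a := by
        rw [mul_smul, inv_smul_eq_iff]; exact hpr
      exact (inv_mul_eq_one.mp (hfree a ha h0 _ h3)).symm

namespace IsIntChar

variable {G : Type*} [Group G] [Fintype G] {d e : ℕ} {f : G → ℤ}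

lemma map_conj (hf : IsIntChar G d f) (g x : G) : f (g * x * g⁻¹) = f x := by
  rw [hf.map_mul_comm, ← mul_assoc, inv_mul_cancel, one_mul]

lemma sum_eq_zero (hf : IsIntChar G d f) (hd : 1 < d) : ∑ x, f x = 0 := by
  by_contra h
  have h1 : ∀ g, f g = d := fun g => by
    have h2 := hf.sum_mul_map_mul (fun _ => 1) (fun _ _ => rfl) g
    simp only [one_mul] at h2
    rw [Fintype.sum_equiv (Equiv.mulRight g) (fun x => f (x * g)) f (fun _ => rfl), mul_comm] at h2
    exact (mul_left_cancel₀ h h2).symm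
  have h3 := hf.sum_sq
  simp only [h1, sum_const, card_univ, nsmul_eq_mul] at h3
  have h4 : (Fintype.card G : ℤ) ≠ 0 := by exact_mod_cast Fintype.card_ne_zero
  have h5 : (d : ℤ) ^ 2 = 1 := mul_left_cancel₀ h4 (h3.trans (mul_one _).symm)
  have h6 : (1 : ℤ) < d := by exact_mod_cast hd
  nlinarith

lemma sum_mul_map_mul_self (hf : IsIntChar G d f) (hd : 1 < d)
    (hG : (Fintype.card G : ℤ) = d * (d + e)) (g : G) :
    ∑ x, f x * f (x * g) = (d + e) * f g := by
  have h := hf.sum_mul_map_mul f hf.map_mul_comm g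
  simp only [← pow_two, hf.sum_sq, hG, mul_assoc] at h
  exact mul_left_cancel₀ (by exact_mod_cast (by omega : d ≠ 0)) h

end IsIntChar
end LargeDegree

namespace LargeDegree
open Finset
open scoped Classical

namespace IsIntChar

variable {G : Type*} [Group G] [Fintype G] {d e : ℕ} {f : G → ℤ}

lemma sum_sq_erase (hf : IsIntChar G d f) (hG : (Fintype.card G : ℤ) = d * (d + e)) :
    ∑ x ∈ univ.erase (1 : G), f x ^ 2 = d * e := by
  rw [Finset.sum_erase_eq_sub (mem_univ _), hf.sum_sq, hG, hf.map_one]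
  ring

lemma abs_le (hf : IsIntChar G d f) (hd : 1 < d) (hG : (Fintype.card G : ℤ) = d * (d + e))
    {x : G} (hx : x ≠ 1) : |f x| ≤ e := by
  let K : Finset G := univ.filter (IsConj x)
  have hK : ∀ y ∈ K, f y = f x := fun y hy => by
    obtain ⟨g, rfl⟩ := isConj_iff.mp (mem_filter.mp hy).2
    exact hf.map_conj g x
  have hK0 : 0 < K.card := Finset.card_pos.mpr ⟨x, Finset.mem_filter.mpr ⟨mem_univ _, IsConj.refl x⟩⟩
  have hd0 : (0 : ℤ) < d := by exact_mod_cast (by omega : 0 < d)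
  obtain ⟨w, hw⟩ := hf.dvd_sum (fun y => if IsConj x y then 1 else 0) (fun y z => by
    have : IsConj (y * z) (z * y) := isConj_iff.mpr ⟨y⁻¹, by group⟩
    have h : IsConj x (y * z) ↔ IsConj x (z * y) := ⟨fun h => h.trans this, fun h =>
      h.trans this.symm⟩
    simp only [h])
  have h1 : (K.card : ℤ) * f x = d * w := by
    rw [← hw]
    simp only [ite_mul, one_mul, zero_mul, ← Finset.sum_filter]
    rw [Finset.sum_congr rfl hK, Finset.sum_const, nsmul_eq_mul]
  have h2 : (K.card : ℤ) * f x ^ 2 ≤ d * e := by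
    rw [← hf.sum_sq_erase hG, ← nsmul_eq_mul, ← Finset.sum_const]
    have h3 : ∑ y ∈ K, f x ^ 2 = ∑ y ∈ K, f y ^ 2 :=
      Finset.sum_congr rfl fun y hy => by rw [hK y hy]
    rw [h3]
    refine Finset.sum_le_sum_of_subset_of_nonneg (fun y hy => ?_) fun _ _ _ => sq_nonneg _
    refine Finset.mem_erase.mpr ⟨?_, mem_univ _⟩
    rintro rfl
    exact hx (isConj_one_left.mp (mem_filter.mp hy).2)
  have h3 : w * f x ≤ e := by
    refine le_of_mul_le_mul_left ?_ hd0
    calc (d : ℤ) * (w * f x) = K.card * f x ^ 2 := by rw [← mul_assoc, ← h1]; ring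
      _ ≤ _ := h2
  have hK1 : (1 : ℤ) ≤ K.card := by exact_mod_cast hK0
  rcases lt_trichotomy (f x) 0 with h | h | h
  · have hw : w ≤ -1 := by
      by_contra hw
      nlinarith
    rw [abs_of_neg h]
    nlinarith
  · simp [h]
  · have hw : 1 ≤ w := by
      by_contra hw
      nlinarith
    rw [abs_of_pos h]
    nlinarith

lemma sum_cube_erase (hf : IsIntChar G d f) (hG : (Fintype.card G : ℤ) = d * (d + e)) {m : ℤ}
    (hm : ∑ x, f x ^ 3 = Fintype.card G * m) :
    ∑ x ∈ univ.erase (1 : G), f x ^ 3 = d * ((d + e) * (m - (d + e) + 2 * e) - e ^ 2) := by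
  rw [Finset.sum_erase_eq_sub (mem_univ _), hm, hG, hf.map_one]
  ring

lemma cube_multiplicity_cases (hf : IsIntChar G d f) (hd : 1 < d)
    (hG : (Fintype.card G : ℤ) = d * (d + e)) (hlt : e ^ 2 < d + e) {m : ℤ}
    (hm : ∑ x, f x ^ 3 = Fintype.card G * m) :
    m - (d + e) + 2 * e = 0 ∨ m - (d + e) + 2 * e = 1 := by
  have h1 := hf.sum_cube_erase hG hm
  have hd0 : (0 : ℤ) < d := by exact_mod_cast (by omega : 0 < d)
  have h2 : |∑ x ∈ univ.erase (1 : G), f x ^ 3| ≤ d * e ^ 2 := by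
    calc |∑ x ∈ univ.erase (1 : G), f x ^ 3| ≤ ∑ x ∈ univ.erase (1 : G), |f x ^ 3| :=
          Finset.abs_sum_le_sum_abs _ _
      _ ≤ ∑ x ∈ univ.erase (1 : G), e * f x ^ 2 := by
          refine Finset.sum_le_sum fun x hx => ?_
          rw [pow_succ', abs_mul, abs_of_nonneg (sq_nonneg (f x))]
          exact mul_le_mul_of_nonneg_right (hf.abs_le hd hG (Finset.ne_of_mem_erase hx))
            (sq_nonneg _)
      _ = _ := by rw [← Finset.mul_sum, hf.sum_sq_erase hG]; ring
  rw [h1, abs_mul, abs_of_pos hd0] at h2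
  have h3 := le_of_mul_le_mul_left h2 hd0
  rw [_root_.abs_le] at h3
  set j := m - (d + e) + 2 * e
  have h4 : (e : ℤ) ^ 2 < d + e := by exact_mod_cast hlt
  have h5 : 0 ≤ j := by nlinarith
  have h6 : j < 2 := by nlinarith
  omega

lemma values_of_cube_multiplicity (hf : IsIntChar G d f) (hd : 1 < d)
    (hG : (Fintype.card G : ℤ) = d * (d + e)) {m : ℤ}
    (hm : ∑ x, f x ^ 3 = Fintype.card G * m) (hj : m - (d + e) + 2 * e = 0) {x : G}
    (hx : x ≠ 1) : f x = 0 ∨ f x = -e := by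
  have h1 : ∑ x ∈ univ.erase (1 : G), f x ^ 2 * (e + f x) = 0 := by
    have h2 : ∀ x, f x ^ 2 * (e + f x) = e * f x ^ 2 + f x ^ 3 := fun x => by ring
    simp only [h2, Finset.sum_add_distrib, ← Finset.mul_sum, hf.sum_sq_erase hG,
      hf.sum_cube_erase hG hm, hj]
    ring
  rw [Finset.sum_eq_zero_iff_of_nonneg] at h1
  · have h2 := h1 x (Finset.mem_erase.mpr ⟨hx, mem_univ x⟩)
    rcases mul_eq_zero.mp h2 with h | h
    · left; exact pow_eq_zero_iff (two_ne_zero) |>.mp h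
    · right; linarith
  · intro y hy
    have := hf.abs_le hd hG (Finset.ne_of_mem_erase hy)
    rw [_root_.abs_le] at this
    exact mul_nonneg (sq_nonneg _) (by linarith)

lemma even_of_cube_multiplicity (hf : IsIntChar G d f) (hd : 1 < d)
    (hG : (Fintype.card G : ℤ) = d * (d + e)) {m : ℤ}
    (hm : ∑ x, f x ^ 3 = Fintype.card G * m) (hj : m - (d + e) + 2 * e = 1) :
    Even ((d : ℤ) + e) := by
  obtain ⟨t, ht⟩ := hf.dvd_sum (fun x => f x * (f x + 1) / 2) (fun x y => by
    rw [hf.map_mul_comm])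
  have h1 : ∀ x, 2 * (f x * (f x + 1) / 2 * f x) = f x ^ 3 + f x ^ 2 := fun x => by
    rw [← mul_assoc, Int.mul_ediv_cancel' (Int.even_mul_succ_self (f x)).two_dvd]
    ring
  have h2 : 2 * (d * t) = d * ((d + e) * (m + 1)) := by
    rw [← ht, Finset.mul_sum]
    simp only [h1, Finset.sum_add_distrib, hm, hf.sum_sq, hG]
    ring
  have hd0 : (d : ℤ) ≠ 0 := by exact_mod_cast (by omega : d ≠ 0)
  have h3 : 2 * t = (d + e) * (m + 1) := mul_left_cancel₀ hd0 (by rw [← h2]; ring)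
  have h4 : m + 1 = (d + e) - 2 * e + 2 := by linarith
  by_contra h
  have h5 : Odd ((d : ℤ) + e) := Int.not_even_iff_odd.mp h
  have h6 : Odd (2 * t) := by
    rw [h3, h4]
    exact h5.mul ((h5.sub_even ⟨e, by ring⟩).add_even ⟨1, by ring⟩)
  exact (Int.not_even_iff_odd.mpr h6) ⟨t, by ring⟩

end IsIntChar
end LargeDegree

namespace LargeDegree
open Finset
open scoped Classical

variable {G : Type*} [Group G] [Fintype G]

/-- The number of ways to write `g` as a product `x * y` with `x ^ 2 = y ^ 2 = 1`. -/
noncomputable def involutionPairs (g : G) : ℤ :=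
  ((univ : Finset G).filter fun x => x * x = 1 ∧ x * g * x = g⁻¹).card

lemma involutionPairs_mul_comm (x y : G) : involutionPairs (x * y) = involutionPairs (y * x) := by
  unfold involutionPairs
  congr 1
  refine Finset.card_bij (fun w _ => x⁻¹ * w * x) (fun w hw => ?_) (fun w _ w' _ h => ?_)
    fun w hw => ⟨x * w * x⁻¹, ?_, by group⟩
  · obtain ⟨h1, h2⟩ := (Finset.mem_filter.mp hw).2
    refine Finset.mem_filter.mpr ⟨mem_univ _, ?_, ?_⟩
    · rw [show x⁻¹ * w * x * (x⁻¹ * w * x) = x⁻¹ * (w * w) * x by group, h1]; group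
    · rw [show x⁻¹ * w * x * (y * x) * (x⁻¹ * w * x) = x⁻¹ * (w * (x * y) * w) * x by group, h2]
      group
  · simpa using h
  · obtain ⟨h1, h2⟩ := (Finset.mem_filter.mp hw).2
    refine Finset.mem_filter.mpr ⟨mem_univ _, ?_, ?_⟩
    · rw [show x * w * x⁻¹ * (x * w * x⁻¹) = x * (w * w) * x⁻¹ by group, h1]; group
    · rw [show x * w * x⁻¹ * (x * y) * (x * w * x⁻¹) = x * (w * (y * x) * w) * x⁻¹ by group, h2]
      group

lemma even_involutionPairs {g z : G} (hz1 : z ≠ 1) (hz : z * z = 1) (hzg : z * g = g * z) :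
    Even (involutionPairs g) := by
  have hzi : z⁻¹ = z := inv_eq_of_mul_eq_one_left hz
  have h : ∑ x ∈ (univ : Finset G).filter (fun x => x * x = 1 ∧ x * g * x = g⁻¹),
      (1 : ZMod 2) = 0 := by
    refine Finset.sum_involution (fun x _ => if x * z = z * x then x * z else z * x * z)
      (fun _ _ => by decide) (fun x _ _ => ?_) (fun x hx => ?_) (fun x _ => ?_)
    · split_ifs with h
      · simpa using hz1
      · intro h2
        apply h
        nth_rewrite 1 [← h2]
        rw [mul_assoc, hz, mul_one]
    · obtain ⟨h1, h2⟩ := (Finset.mem_filter.mp hx).2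
      refine Finset.mem_filter.mpr ⟨mem_univ _, ?_⟩
      split_ifs with h
      · constructor
        · rw [mul_assoc, ← mul_assoc z x, ← h, mul_assoc x z z, hz, mul_one, h1]
        · rw [mul_assoc x z g, hzg, h, ← mul_assoc, ← mul_assoc, mul_assoc (x * g) z z, hz,
            mul_one, h2]
      · constructor
        · rw [show z * x * z * (z * x * z) = z * (x * (z * z) * x) * z by group, hz, mul_one, h1,
            mul_one, hz]
        · rw [show z * x * z * g * (z * x * z) = z * (x * (z * g * z) * x) * z by group, hzg,
            mul_assoc g, hz, mul_one, h2, show z * g⁻¹ * z = (z⁻¹ * g * z⁻¹)⁻¹ by group, hzi,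
            hzg, mul_assoc, hz, mul_one]
    · by_cases h : x * z = z * x
      · have h3 : x * z * z = z * (x * z) := by rw [h, mul_assoc, h]
        simp only [h, if_true]
        rw [if_pos (by rw [← h, h3]), ← h, mul_assoc, hz, mul_one]
      · have h3 : ¬ z * x * z * z = z * (z * x * z) := by
          intro h3
          apply h
          rw [mul_assoc, hz, mul_one, ← mul_assoc, ← mul_assoc, hz, one_mul] at h3
          exact h3.symm
        simp only [h, if_false]
        rw [if_neg h3, ← mul_assoc, ← mul_assoc, hz, one_mul, mul_assoc, hz, mul_one]
  unfold involutionPairs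
  rw [Finset.sum_const, nsmul_eq_mul, mul_one, ZMod.natCast_eq_zero_iff] at h
  exact (Int.even_coe_nat _).mpr (even_iff_two_dvd.mpr h)

namespace IsIntChar
variable {d e : ℕ} {f : G → ℤ}

lemma even_of_sum_involutions (hf : IsIntChar G d f) (hd : 1 < d)
    (hG : (Fintype.card G : ℤ) = d * (d + e)) (hev : Even ((d : ℤ) + e)) {w : ℤ}
    (hw : ∑ x ∈ univ.filter (fun x : G => x * x = 1), f x = d * w) : Even w := by
  have hd0 : (d : ℤ) ≠ 0 := by exact_mod_cast (by omega : d ≠ 0)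
  let I : G → ℤ := fun x => if x * x = 1 then 1 else 0
  have hI : ∀ x y : G, I (x * y) = I (y * x) := fun x y => by
    have : x * y * (x * y) = 1 ↔ y * x * (y * x) = 1 := by
      constructor <;> intro h
      · rw [show y * x * (y * x) = x⁻¹ * (x * y * (x * y)) * x by group, h]; group
      · rw [show x * y * (x * y) = y⁻¹ * (y * x * (y * x)) * y by group, h]; group
    simp only [I, this]
  have hIf : ∀ F : G → ℤ, ∑ x, I x * F x = ∑ x ∈ univ.filter (fun x : G => x * x = 1), F x :=
    fun F => by simp only [I, ite_mul, one_mul, zero_mul, ← Finset.sum_filter]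
  have hIg : ∀ g, ∑ x ∈ univ.filter (fun x : G => x * x = 1), f (x * g) = w * f g := fun g => by
    have h := hf.sum_mul_map_mul I hI g
    rw [hIf, hIf, hw, mul_assoc] at h
    exact mul_left_cancel₀ hd0 h
  have hc2 : ∑ g, involutionPairs g * f g = d * (w * w) := by
    have h1 : ∑ g, involutionPairs g * f g =
        ∑ x ∈ univ.filter (fun x : G => x * x = 1),
          ∑ y ∈ univ.filter (fun y : G => y * y = 1), f (y * x) := by
      have h2 : ∀ g, involutionPairs g * f g =
          ∑ x ∈ univ.filter (fun x : G => x * x = 1), if x * g * x = g⁻¹ then f g else 0 :=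
        fun g => by
          rw [← Finset.sum_filter, Finset.filter_filter, Finset.sum_const, nsmul_eq_mul]
          rfl
      simp_rw [h2]
      rw [Finset.sum_comm]
      refine Finset.sum_congr rfl fun x hx => ?_
      have hx' : x * x = 1 := (Finset.mem_filter.mp hx).2
      rw [← Finset.sum_filter]
      refine Finset.sum_bij (fun g _ => x * g) (fun g hg => ?_) (fun _ _ _ _ h => ?_)
        (fun y hy => ⟨x * y, ?_, ?_⟩) (fun g _ => ?_)
      · have := (Finset.mem_filter.mp hg).2
        refine Finset.mem_filter.mpr ⟨mem_univ _, ?_⟩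
        rw [← mul_assoc, this, inv_mul_cancel]
      · exact mul_left_cancel h
      · have := (Finset.mem_filter.mp hy).2
        refine Finset.mem_filter.mpr ⟨mem_univ _, ?_⟩
        rw [← mul_assoc, hx', one_mul, mul_inv_rev, inv_eq_of_mul_eq_one_left hx',
          inv_eq_of_mul_eq_one_left this]
      · rw [← mul_assoc, hx', one_mul]
      · rw [hf.map_mul_comm, ← mul_assoc, hx', one_mul]
    rw [h1]
    simp_rw [hIg, ← Finset.mul_sum, hw]
    ring
  let Q : G → Prop := fun g => ∃ z : G, z ≠ 1 ∧ z * z = 1 ∧ z * g = g * z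
  have hQ : ∀ x y, Q (x * y) → Q (y * x) := fun x y ⟨z, h1, h2, h3⟩ =>
    ⟨x⁻¹ * z * x, by simpa [mul_assoc, inv_mul_eq_one] using h1,
      by rw [show x⁻¹ * z * x * (x⁻¹ * z * x) = x⁻¹ * (z * z) * x by group, h2]; group, by
      rw [show x⁻¹ * z * x * (y * x) = x⁻¹ * (z * (x * y)) * x by group, h3]; group⟩
  have hQ' : ∀ x y, Q (x * y) ↔ Q (y * x) := fun x y => ⟨hQ x y, hQ y x⟩
  obtain ⟨t, ht⟩ := hf.dvd_sum (fun g => if Q g then involutionPairs g / 2 else 0) (fun x y => by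
    simp only [hQ' x y, involutionPairs_mul_comm x y])
  let c : G → ℤ := fun g => if Q g then 0 else involutionPairs g
  have hc : ∀ x y, c (x * y) = c (y * x) := fun x y => by
    simp only [c, hQ' x y, involutionPairs_mul_comm x y]
  obtain ⟨s, hs⟩ := hf.dvd_sum c hc
  have hsum : d * (w * w) = d * (2 * t + s) := by
    rw [← hc2, mul_add, mul_left_comm, ← ht, ← hs, Finset.mul_sum, ← Finset.sum_add_distrib]
    refine Finset.sum_congr rfl fun g _ => ?_
    simp only [c]
    split_ifs with h
    · obtain ⟨z, h1, h2, h3⟩ := h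
      rw [zero_mul, add_zero, ← mul_assoc,
        Int.mul_ediv_cancel' (even_involutionPairs h1 h2 h3).two_dvd]
    · simp
  have hw2 := mul_left_cancel₀ hd0 hsum
  have hse : Even s := by
    by_contra hodd
    obtain ⟨P⟩ : Nonempty (Sylow 2 G) := inferInstance
    have : Fact (Nat.Prime 2) := ⟨Nat.prime_two⟩
    have h1 : (Fintype.card P : ℤ) ∣ d * s := by
      rw [← hs]
      refine card_dvd_sum_of_invariant ((MulAut.toPerm G).comp (MulAut.conj.comp P.1.subtype)) univ
        (fun _ _ _ => mem_univ _) (fun p g _ => ?_) (fun g _ h p hp => ?_)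
      · change c ((p : G) * g * (p : G)⁻¹) * f ((p : G) * g * (p : G)⁻¹) = _
        rw [hf.map_conj, hc, inv_mul_cancel_left]
      · have h3 : ¬ Q g := fun hq => h (by simp [c, hq])
        by_contra hp1
        have hpg : (p : G) * g = g * p := mul_inv_eq_iff_eq_mul.mp hp
        obtain ⟨k, hk⟩ := IsPGroup.exists_orderOf_eq_pow P.2 p
        obtain _ | k := k
        · exact hp1 (orderOf_eq_one_iff.mp (by simpa using hk))
        · refine h3 ⟨(p : G) ^ 2 ^ k, fun h4 => ?_, ?_, (Commute.pow_left hpg _)⟩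
          · have h5 : orderOf p ∣ 2 ^ k := orderOf_dvd_of_pow_eq_one (by exact_mod_cast h4)
            rw [hk] at h5
            have := Nat.le_of_dvd (by positivity) h5
            exact absurd this (not_le.mpr (Nat.pow_lt_pow_right (by norm_num) (by omega)))
          · have h5 : p ^ 2 ^ (k + 1) = 1 := by rw [← hk, pow_orderOf_eq_one]
            rw [← pow_two, ← pow_mul, ← pow_succ]
            exact_mod_cast h5
    have h2 : (Fintype.card P : ℤ) ∣ d := by
      obtain ⟨k, hk⟩ := IsPGroup.iff_card.mp P.2
      rw [Nat.card_eq_fintype_card] at hk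
      rw [hk] at h1 ⊢
      refine IsCoprime.dvd_of_dvd_mul_right ?_ h1
      push_cast
      refine IsCoprime.pow_left ?_
      exact Int.isCoprime_two_left.mpr (Int.not_even_iff_odd.mp hodd)
    have h3 : (Fintype.card P : ℤ) * 2 ∣ Fintype.card P * P.index := by
      rw [← Nat.cast_mul, ← Nat.card_eq_fintype_card, Subgroup.card_mul_index,
        Nat.card_eq_fintype_card, Nat.card_eq_fintype_card, hG]
      exact mul_dvd_mul h2 hev.two_dvd
    have h4 : (2 : ℤ) ∣ P.index :=
      (mul_dvd_mul_iff_left (by exact_mod_cast Fintype.card_ne_zero)).mp h3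
    exact P.not_dvd_index (by exact_mod_cast h4)
  have : Even (w * w) := by rw [hw2]; exact (even_two_mul t).add hse
  rcases Int.even_mul.mp this with h | h <;> exact h

end IsIntChar
end LargeDegree

namespace LargeDegree
open Finset
open scoped Classical

namespace IsIntChar
variable {G : Type*} [Group G] [Fintype G] {d e : ℕ} {f : G → ℤ}

lemma sum_abs_erase_le (hf : IsIntChar G d f) (hd : 1 < d)
    (hG : (Fintype.card G : ℤ) = d * (d + e)) (hlt : e ^ 2 < d + e) {m : ℤ}
    (hm : ∑ x, f x ^ 3 = Fintype.card G * m) (hj : m - (d + e) + 2 * e = 1) :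
    ∑ x ∈ univ.erase (1 : G), |f x| ≤ d * (e - 1) := by
  have hd0 : (0 : ℤ) < d := by exact_mod_cast (by omega : 0 < d)
  have hlt' : (e : ℤ) ^ 2 < d + e := by exact_mod_cast hlt
  obtain ⟨t, ht⟩ := hf.dvd_sum (fun x => SignType.sign (f x)) (fun x y => by
    rw [hf.map_mul_comm])
  simp only [sign_mul_self] at ht
  have h1 : ∑ x ∈ univ.erase (1 : G), |f x| = d * (t - 1) := by
    rw [Finset.sum_erase_eq_sub (mem_univ _), ht, hf.map_one, abs_of_pos hd0]
    ring
  rw [h1]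
  refine mul_le_mul_of_nonneg_left ?_ hd0.le
  have habs : ∀ x, |f x| ≤ f x ^ 2 := fun x => by
    rw [← sq_abs]
    exact Int.le_self_sq _
  have h2 : d * (t - 1) ≤ d * (e : ℤ) := by
    rw [← h1, ← hf.sum_sq_erase hG]
    exact Finset.sum_le_sum fun x _ => habs x
  have h3 : t - 1 ≤ e := le_of_mul_le_mul_left h2 hd0
  by_contra hcon
  have h4 : t - 1 = e := by omega
  have h5 : ∑ x ∈ univ.erase (1 : G), (f x ^ 2 - |f x|) = 0 := by
    rw [Finset.sum_sub_distrib, h1, hf.sum_sq_erase hG, h4, sub_self]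
  rw [Finset.sum_eq_zero_iff_of_nonneg (fun x _ => sub_nonneg.mpr (habs x))] at h5
  have h6 : ∑ x ∈ univ.erase (1 : G), f x ^ 3 = ∑ x ∈ univ.erase (1 : G), f x := by
    refine Finset.sum_congr rfl fun x hx => ?_
    have h7 := h5 x hx
    have h8 : |f x| * (|f x| - 1) = 0 := by rw [← sq_abs] at h7; linarith
    rcases mul_eq_zero.mp h8 with h | h
    · rw [abs_eq_zero.mp h]; norm_num
    · have h9 : |f x| ^ 2 = 1 := by rw [show |f x| = 1 by linarith]; norm_num
      rw [sq_abs] at h9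
      rw [pow_succ, h9, one_mul]
  rw [hf.sum_cube_erase hG hm, Finset.sum_erase_eq_sub (mem_univ _), hf.sum_eq_zero hd, hf.map_one,
    hj] at h6
  nlinarith

lemma cube_multiplicity_ne_one (hf : IsIntChar G d f) (hd : 1 < d)
    (hG : (Fintype.card G : ℤ) = d * (d + e)) (hlt : e ^ 2 < d + e) {a b : ℤ}
    (hm : ∑ x, f x ^ 3 = Fintype.card G * (a + b))
    (hk : ∑ x, f (x ^ 2) * f x = Fintype.card G * (a - b)) :
    a + b - (d + e) + 2 * e ≠ 1 := by
  intro hj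
  have hd0 : (0 : ℤ) < d := by exact_mod_cast (by omega : 0 < d)
  have hlt' : (e : ℤ) ^ 2 < d + e := by exact_mod_cast hlt
  have hev := hf.even_of_cube_multiplicity hd hG hm hj
  have hodd : Odd (a - b) := by
    have : a - b = (d + e) - 2 * e - 2 * b + 1 := by linarith
    rw [this]
    exact ((hev.sub (even_two_mul _)).sub (even_two_mul _)).add_one
  let I := univ.filter (fun x : G => x * x = 1)
  have hI1 : (1 : G) ∈ I := by simp [I]
  obtain ⟨w, hw⟩ : (d : ℤ) ∣ ∑ x ∈ I, f x := by
    have := hf.dvd_sum (fun x => if x * x = 1 then 1 else 0) (fun x y => by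
      have : x * y * (x * y) = 1 ↔ y * x * (y * x) = 1 := by
        constructor <;> intro h
        · rw [show y * x * (y * x) = x⁻¹ * (x * y * (x * y)) * x by group, h]; group
        · rw [show x * y * (x * y) = y⁻¹ * (y * x * (y * x)) * y by group, h]; group
      simp only [this])
    simpa only [ite_mul, one_mul, zero_mul, ← Finset.sum_filter] using this
  have hwe := hf.even_of_sum_involutions hd hG hev hw
  have hsplit : ∀ F : G → ℤ, ∑ x, F x = ∑ x ∈ I, F x + ∑ x ∈ univ \ I, F x := fun F => by
    rw [add_comm, Finset.sum_sdiff (subset_univ I)]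
  have h1 : ∑ x ∈ I, f (x ^ 2) * f x = d * (d * w) := by
    rw [← hw, Finset.mul_sum]
    refine Finset.sum_congr rfl fun x hx => ?_
    rw [pow_two, (Finset.mem_filter.mp hx).2, hf.map_one]
  rw [hsplit, h1, hG] at hk
  have h2 : |∑ x ∈ univ \ I, f (x ^ 2) * f x| ≤ e * ∑ x ∈ univ \ I, |f x| := by
    rw [Finset.mul_sum]
    refine (Finset.abs_sum_le_sum_abs _ _).trans (Finset.sum_le_sum fun x hx => ?_)
    rw [abs_mul]
    refine mul_le_mul_of_nonneg_right (hf.abs_le hd hG ?_) (abs_nonneg _)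
    intro h
    simp [I, ← pow_two, h] at hx
  have h3 : |(d : ℤ) * w| ≤ ∑ x ∈ I, |f x| := by
    rw [← hw]
    exact Finset.abs_sum_le_sum_abs _ _
  have h4 : ∑ x ∈ I, |f x| + ∑ x ∈ univ \ I, |f x| ≤ d * e := by
    rw [← hsplit]
    have := hf.sum_abs_erase_le hd hG hlt hm hj
    rw [Finset.sum_erase_eq_sub (mem_univ _), hf.map_one, abs_of_pos hd0] at this
    linarith
  have h5 : |(d : ℤ) * ((d + e) * (a - b - w))| ≤ d * e ^ 2 := by
    have h6 : (d : ℤ) * ((d + e) * (a - b - w)) =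
        ∑ x ∈ univ \ I, f (x ^ 2) * f x + (-e) * (d * w) := by linarith
    have he0 : (0 : ℤ) ≤ e := by positivity
    rw [h6]
    calc _ ≤ _ := abs_add_le _ _
      _ ≤ e * ∑ x ∈ univ \ I, |f x| + e * ∑ x ∈ I, |f x| := by
        refine add_le_add h2 ?_
        rw [abs_mul, abs_neg, abs_of_nonneg he0]
        exact mul_le_mul_of_nonneg_left h3 he0
      _ ≤ _ := by nlinarith
  rw [abs_mul, abs_of_pos hd0] at h5
  have h6 := le_of_mul_le_mul_left h5 hd0
  rw [_root_.abs_le] at h6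
  have h7 : a - b - w = 0 := by
    have h8 : a - b - w < 1 := by nlinarith
    have h9 : -1 < a - b - w := by nlinarith
    omega
  have h8 : a - b = w := by linarith
  rw [h8] at hodd
  exact (Int.not_even_iff_odd.mpr hodd) hwe

/-- A character of large degree takes a single nonzero value off the identity. -/
lemma eq_zero_or_eq_neg (hf : IsIntChar G d f) (hd : 1 < d)
    (hG : (Fintype.card G : ℤ) = d * (d + e)) (hlt : e ^ 2 < d + e) {x : G} (hx : x ≠ 1) :
    f x = 0 ∨ f x = -e := by
  obtain ⟨a, b, hm, hk⟩ := hf.sum_cube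
  rcases hf.cube_multiplicity_cases hd hG hlt hm with h | h
  · exact hf.values_of_cube_multiplicity hd hG hm h hx
  · exact absurd h (hf.cube_multiplicity_ne_one hd hG hlt hm hk)

end IsIntChar
end LargeDegree

namespace LargeDegree
open Finset
open scoped Classical

/-- The structure forced on a group with a character that only takes the values `e * (q - 1)`, `-e`
and `0`: the support `L` of this character is a normal subgroup of order `q`, whose nontrivial
elements are conjugate, and every element outside `L` is conjugate to its whole coset. -/
structure IsCaminaKernel {G : Type*} [Group G] [Fintype G] (L : Subgroup G) (e q : ℕ) : Prop where
  normal : L.Normal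
  card_eq : Nat.card L = q
  card_group : Nat.card G = e ^ 2 * q * (q - 1)
  two_le : 2 ≤ e
  lt : e < q
  isConj : ∀ x ∈ L, x ≠ 1 → ∀ y ∈ L, y ≠ 1 → IsConj x y
  isConj_mul : ∀ x ∉ L, ∀ z ∈ L, IsConj x (x * z)
  card_dvd : ∀ H : Subgroup G, H ⊓ L = ⊥ → Nat.card H ∣ e * (q - 1)
  card_sq : (q : ℤ) * #{g : G | g ^ 2 = 1} - #{g : G | g ^ 2 ∈ L} = e * q * (q - 1) ∨
    (q : ℤ) * #{g : G | g ^ 2 = 1} - #{g : G | g ^ 2 ∈ L} = -(e * q * (q - 1))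

namespace IsIntChar
variable {G : Type*} [Group G] [Fintype G] {d e : ℕ} {f : G → ℤ}

/-- A character that only takes the values `d`, `0` and `-e` is supported on a subgroup. -/
lemma exists_isCaminaKernel (hf : IsIntChar G d f) (hd : 1 < d) (he : 2 ≤ e)
    (hG : (Fintype.card G : ℤ) = d * (d + e)) (hlt : e ^ 2 < d + e) :
    ∃ (L : Subgroup G) (q : ℕ), d = e * (q - 1) ∧ IsCaminaKernel L e q := by
  have hval := fun x hx => hf.eq_zero_or_eq_neg hd hG hlt (x := x) hx
  set S : Finset G := univ.filter (fun x => f x ≠ 0) with hS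
  set q := #S with hq
  have hd0 : (0 : ℤ) < d := by exact_mod_cast (by omega : 0 < d)
  have he0 : (0 : ℤ) < e := by exact_mod_cast (by omega : 0 < e)
  have hmem : ∀ x, x ∈ S ↔ f x ≠ 0 := fun x => by simp [hS]
  have h1S : (1 : G) ∈ S := by rw [hmem, hf.map_one]; exact hd0.ne'
  have hq1 : 1 ≤ q := Finset.card_pos.mpr ⟨1, h1S⟩
  have hneg : ∀ x ∈ S, x ≠ 1 → f x = -e := fun x hx hx1 =>
    (hval x hx1).resolve_left ((hmem x).mp hx)
  have hdq : (d : ℤ) = e * (q - 1) := by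
    have h2 : ∑ x, f x = ∑ x ∈ S, f x := by
      rw [hS, Finset.sum_filter_ne_zero]
    rw [hf.sum_eq_zero hd, ← Finset.add_sum_erase _ _ h1S, hf.map_one,
      Finset.sum_congr rfl (fun x hx => hneg x (mem_of_mem_erase hx) (ne_of_mem_erase hx)),
      Finset.sum_const, Finset.card_erase_of_mem h1S, nsmul_eq_mul, Nat.cast_sub hq1] at h2
    push_cast at h2
    linarith
  have hfx : ∀ x, f x = e * (q * (if x = 1 then 1 else 0) - if x ∈ S then 1 else 0) := by
    intro x
    by_cases hx1 : x = 1
    · subst hx1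
      rw [hf.map_one, if_pos rfl, if_pos h1S, hdq]; ring
    · rw [if_neg hx1]
      split_ifs with h
      · rw [hneg x h hx1]; ring
      · rw [not_not.mp ((hmem x).not.mp h)]; ring
  have hmul : ∀ x ∈ S, ∀ g ∈ S, x * g ∈ S := by
    intro x hx g hg
    by_cases hg1 : g = 1
    · rwa [hg1, mul_one]
    have hginv : g⁻¹ ∈ S := by rw [hmem, hf.map_inv]; exact (hmem g).mp hg
    have h2 := hf.sum_mul_map_mul_self hd hG g
    have h3 : ∑ x, f x * f (x * g) =
        ∑ x, (e : ℤ) ^ 2 * (q * q * (if x = 1 then (if x * g = 1 then 1 else 0) else 0)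
          - q * (if x = 1 then (if x * g ∈ S then 1 else 0) else 0)
          - q * (if x = g⁻¹ then (if x ∈ S then 1 else 0) else 0)
          + (if x ∈ S ∧ x * g ∈ S then 1 else 0)) := by
      refine Finset.sum_congr rfl fun y _ => ?_
      rw [hfx y, hfx (y * g)]
      simp only [← mul_eq_one_iff_eq_inv, ite_and]
      split_ifs <;> ring
    rw [h3, ← Finset.mul_sum, Finset.sum_add_distrib, Finset.sum_sub_distrib,
      Finset.sum_sub_distrib, ← Finset.mul_sum, ← Finset.mul_sum, ← Finset.mul_sum,
      Finset.sum_ite_eq' univ (1 : G), Finset.sum_ite_eq' univ (1 : G), Finset.sum_ite_eq' univ (g⁻¹),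
      Finset.sum_boole] at h2
    simp only [mem_univ, if_true, one_mul, if_neg hg1, if_pos hg, if_pos hginv, hneg g hg hg1] at h2
    have h4 : ((#{x | x ∈ S ∧ x * g ∈ S} : ℕ) : ℤ) = q := by
      have h5 : (e : ℤ) ^ 2 * (#{x | x ∈ S ∧ x * g ∈ S} : ℕ) = e ^ 2 * q := by
        rw [hdq] at h2
        linarith
      exact mul_left_cancel₀ (pow_ne_zero 2 he0.ne') h5
    have h6 : ({x | x ∈ S ∧ x * g ∈ S} : Finset G) = S := by
      apply Finset.eq_of_subset_of_card_le
      · intro y hy; simp only [mem_filter] at hy; exact hy.2.1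
      · exact_mod_cast h4.ge
    rw [← h6] at hx
    exact (mem_filter.mp hx).2.2
  let L : Subgroup G :=
    { carrier := {x | x ∈ S}
      mul_mem' := fun {a b} ha hb => hmul a ha b hb
      one_mem' := h1S
      inv_mem' := fun {a} ha => by
        change a⁻¹ ∈ S
        rw [hmem, hf.map_inv]; exact (hmem a).mp ha }
  have hL : ∀ x, x ∈ L ↔ x ∈ S := fun x => Iff.rfl
  have hqG : (Fintype.card G : ℤ) = e ^ 2 * q * (q - 1) := by
    rw [hG, hdq]; ring
  have heq : e < q := by
    have h2 : (e : ℤ) ^ 2 < d + e := by exact_mod_cast hlt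
    rw [hdq] at h2
    have h3 : (e : ℤ) * e < e * q := by linarith
    exact_mod_cast lt_of_mul_lt_mul_left h3 he0.le
  have hcardL : Nat.card L = q := by
    exact Nat.subtype_card S fun _ => Iff.rfl
  have hclass : ∀ x : G, ∀ y z : G,
      (if IsConj x (y * z) then (1 : ℤ) else 0) = if IsConj x (z * y) then 1 else 0 := by
    intro x y z
    have h2 : IsConj (y * z) (z * y) := isConj_iff.mpr ⟨y⁻¹, by group⟩
    exact if_congr ⟨fun h => h.trans h2, fun h => h.trans h2.symm⟩ rfl rfl
  have hfconj : ∀ x y, IsConj x y → f x = f y := by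
    intro x y h
    obtain ⟨c, rfl⟩ := isConj_iff.mp h
    exact (hf.map_conj c x).symm
  refine ⟨L, q, ?_, ⟨⟨?_⟩, hcardL, ?_, he, heq, ?_, ?_, ?_, ?_⟩⟩
  · zify [hq1]; exact hdq
  · intro x hx g
    rw [hL, hmem, hf.map_conj]; exact (hmem x).mp hx
  · rw [Nat.card_eq_fintype_card]; zify [hq1]; exact hqG
  · intro x hx hx1 y hy hy1
    by_contra hxy
    have h2 := hf.sum_mul_map_mul (fun z => if IsConj x z then 1 else 0) (hclass x) y⁻¹
    have hterm : ∀ z, (if IsConj x z then (1 : ℤ) else 0) * f (z * y⁻¹) =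
        (if IsConj x z then (1 : ℤ) else 0) * (-e) := by
      intro z
      split_ifs with h
      · have hz : z ∈ S := by rw [hmem, ← hfconj x z h]; exact (hmem x).mp hx
        rw [hneg (z * y⁻¹) (hmul z hz _ (L.inv_mem hy))]
        rw [Ne, mul_inv_eq_one]
        rintro rfl
        exact hxy h
      · simp
    have hterm' : ∀ z, (if IsConj x z then (1 : ℤ) else 0) * f z =
        (if IsConj x z then (1 : ℤ) else 0) * (-e) := by
      intro z
      split_ifs with h
      · rw [← hfconj x z h, hneg x hx hx1]
      · simp
    simp only [hterm, hterm', ← Finset.sum_mul, hf.map_inv, hneg y hy hy1] at h2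
    have hpos : (0 : ℤ) < ∑ z, if IsConj x z then (1 : ℤ) else 0 := by
      rw [Finset.sum_boole]
      exact_mod_cast Finset.card_pos.mpr ⟨x, mem_filter.mpr ⟨mem_univ _, IsConj.refl x⟩⟩
    have := mul_pos (mul_pos hd0 hpos) he0
    have := mul_pos (mul_pos hpos he0) he0
    linarith
  · intro x hx z hz
    have hfx0 : f x = 0 := not_not.mp ((hmem x).not.mp hx)
    have h2 := hf.sum_mul_map_mul (fun y => if IsConj x y then 1 else 0) (hclass x) x⁻¹
    rw [hf.map_inv, hfx0, mul_zero] at h2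
    have h3 := (mul_eq_zero.mp h2).resolve_left hd0.ne'
    have h4 : ∀ y, (if IsConj x y then (1 : ℤ) else 0) * f (y * x⁻¹) =
        e * (q * (if y = x then 1 else 0) - if IsConj x y ∧ y * x⁻¹ ∈ S then 1 else 0) := by
      intro y
      rw [hfx, mul_inv_eq_one]
      by_cases hyx : y = x
      · subst hyx
        simp only [IsConj.refl y, mul_inv_cancel, h1S, and_self, if_true, one_mul]
      · simp only [hyx, if_false, ite_and]
        split_ifs <;> ring
    simp only [h4] at h3
    rw [← Finset.mul_sum, Finset.sum_sub_distrib, ← Finset.mul_sum,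
      Finset.sum_ite_eq' univ x, if_pos (mem_univ _), Finset.sum_boole] at h3
    have h5 : ((#{y | IsConj x y ∧ y * x⁻¹ ∈ S} : ℕ) : ℤ) = q := by
      have := (mul_eq_zero.mp h3).resolve_left he0.ne'
      linarith
    have h6 : ({y | IsConj x y ∧ y * x⁻¹ ∈ S} : Finset G) = S.image (fun w => w * x) := by
      apply Finset.eq_of_subset_of_card_le
      · intro y hy
        simp only [mem_filter, mem_univ, true_and] at hy
        exact mem_image.mpr ⟨_, hy.2, by group⟩
      · rw [Finset.card_image_of_injective _ (mul_left_injective x)]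
        exact_mod_cast h5.ge
    have h7 : x * z ∈ S.image (fun w => w * x) :=
      mem_image.mpr ⟨x * z * x⁻¹, by
        rw [hmem, hf.map_conj]; exact (hmem z).mp hz, by group⟩
    rw [← h6] at h7
    exact (mem_filter.mp h7).2.1
  · intro H hH
    have h2 := hf.card_dvd_sum H (univ.filter (· ∈ H)) (by simp)
    have h3 : ∑ x ∈ univ.filter (· ∈ H), f x = d := by
      rw [Finset.sum_eq_single (1 : G), hf.map_one]
      · intro x hx hx1
        by_contra h
        have : x ∈ H ⊓ L := ⟨(mem_filter.mp hx).2, (hmem x).mpr h⟩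
        rw [hH] at this
        exact hx1 (Subgroup.mem_bot.mp this)
      · intro h; exact absurd (mem_filter.mpr ⟨mem_univ _, H.one_mem⟩) h
    rw [h3, hdq, ← Fintype.card_subtype] at h2
    rw [Nat.card_eq_fintype_card]
    zify [hq1]
    exact h2
  · have h2 : ∑ x, f (x ^ 2) = e * (q * #{g : G | g ^ 2 = 1} - #{g : G | g ^ 2 ∈ L}) := by
      simp only [hfx]
      rw [← Finset.mul_sum, Finset.sum_sub_distrib, ← Finset.mul_sum, Finset.sum_boole,
        Finset.sum_boole]
      simp only [hL]
    have h3 := hf.sum_map_sq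
    rw [h2, hqG] at h3
    refine h3.imp (fun h => ?_) (fun h => ?_) <;> apply mul_left_cancel₀ he0.ne' <;>
      linarith

end IsIntChar
end LargeDegree

namespace LargeDegree
open Finset
open scoped Classical

/-- The orbit-stabilizer theorem for the conjugation action of a subgroup. -/
lemma card_mul_card_inf_centralizer {G : Type*} [Group G] [Fintype G] (K : Subgroup G)
    (T : Finset G) (x : G) (hKT : ∀ k ∈ K, k * x * k⁻¹ ∈ T)
    (hTK : ∀ y ∈ T, ∃ k ∈ K, k * x * k⁻¹ = y) :
    #T * Nat.card (K ⊓ Subgroup.centralizer {x} : Subgroup G) = Nat.card K := by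
  have h1 : ∀ H : Subgroup G, Nat.card H = #{g : G | g ∈ H} := fun H =>
    Nat.subtype_card _ (by simp)
  rw [h1, h1 K, Finset.card_eq_sum_card_fiberwise (f := fun k => k * x * k⁻¹) (t := T)
    (s := ({g : G | g ∈ K} : Finset G))
    (fun k hk => hKT k (mem_filter.mp hk).2)]
  refine (Finset.sum_const_nat ?_).symm
  intro y hy
  obtain ⟨k, hk, rfl⟩ := hTK y hy
  symm
  refine Finset.card_bij (fun g _ => k * g) ?_ (fun _ _ _ _ h => mul_left_cancel h) ?_
  · intro g hg
    simp only [Subgroup.mem_inf, Subgroup.mem_centralizer_singleton_iff, mem_filter, mem_univ,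
      true_and] at hg ⊢
    refine ⟨K.mul_mem hk hg.1, ?_⟩
    have h3 : g * x * g⁻¹ = x := by rw [hg.2]; group
    calc k * g * x * (k * g)⁻¹ = k * (g * x * g⁻¹) * k⁻¹ := by group
      _ = _ := by rw [h3]
  · intro g hg
    simp only [mem_filter, mem_univ, true_and] at hg
    refine ⟨k⁻¹ * g, ?_, by group⟩
    simp only [Subgroup.mem_inf, Subgroup.mem_centralizer_singleton_iff, mem_filter, mem_univ,
      true_and]
    refine ⟨K.mul_mem (K.inv_mem hk) hg.1, ?_⟩
    calc k⁻¹ * g * x = k⁻¹ * (g * x * g⁻¹) * g := by group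
      _ = x * (k⁻¹ * g) := by rw [hg.2]; group

namespace IsCaminaKernel
variable {G : Type*} [Group G] [Fintype G] {L : Subgroup G} {e q : ℕ}

lemma card_filter_mem (hL : IsCaminaKernel L e q) : #{g : G | g ∈ L} = q := by
  rw [← hL.card_eq]
  exact (Nat.subtype_card _ (by simp)).symm

lemma exists_prime (hL : IsCaminaKernel L e q) :
    ∃ p, p.Prime ∧ (∀ x ∈ L, x ^ p = 1) ∧ (∃ l, q = p ^ l) ∧ p ∣ q := by
  have hq : q ≠ 1 := by have := hL.two_le; have := hL.lt; omega
  have hp := Nat.minFac_prime hq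
  have : Fact (q.minFac.Prime) := ⟨hp⟩
  obtain ⟨⟨x, hx⟩, hxo⟩ := exists_prime_orderOf_dvd_card' (G := L) q.minFac
    (by rw [hL.card_eq]; exact Nat.minFac_dvd q)
  rw [Subgroup.orderOf_mk] at hxo
  have hx1 : x ≠ 1 := by
    rintro rfl
    rw [orderOf_one] at hxo
    exact hp.one_lt.ne hxo
  have hexp : ∀ y ∈ L, y ^ q.minFac = 1 := by
    intro y hy
    by_cases hy1 : y = 1
    · rw [hy1, one_pow]
    · obtain ⟨c, rfl⟩ := isConj_iff.mp (hL.isConj x hx hx1 y hy hy1)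
      rw [conj_pow, ← hxo, pow_orderOf_eq_one]
      group
  refine ⟨q.minFac, hp, hexp, ?_, Nat.minFac_dvd q⟩
  have hpg : IsPGroup q.minFac L := fun y => ⟨1, by
    rw [pow_one]; exact Subtype.ext (hexp y y.2)⟩
  obtain ⟨l, hl⟩ := IsPGroup.iff_card.mp hpg
  exact ⟨l, hL.card_eq.symm.trans hl⟩

lemma isMulCommutative (hL : IsCaminaKernel L e q) {x y : G} (hx : x ∈ L) (hy : y ∈ L) :
    x * y = y * x := by
  obtain ⟨p, hp, -, ⟨l, hl⟩, -⟩ := hL.exists_prime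
  have : Fact p.Prime := ⟨hp⟩
  have hpg : IsPGroup p L := IsPGroup.of_card (hL.card_eq.trans hl)
  have hnt : Nontrivial L := by
    rw [← Finite.one_lt_card_iff_nontrivial, hL.card_eq]
    have := hL.two_le; have := hL.lt; omega
  have := hpg.center_nontrivial
  obtain ⟨⟨⟨c, hcL⟩, hc⟩, hc1⟩ := exists_ne (1 : Subgroup.center L)
  have hc1' : c ≠ 1 := fun h => hc1 (by ext; exact h)
  by_cases hx1 : x = 1
  · rw [hx1, one_mul, mul_one]
  · obtain ⟨g, rfl⟩ := isConj_iff.mp (hL.isConj c hcL hc1' x hx hx1)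
    have hy' : g⁻¹ * y * g ∈ L := by
      have := hL.normal.conj_mem y hy g⁻¹
      rwa [inv_inv] at this
    have h2 : (g⁻¹ * y * g) * c = c * (g⁻¹ * y * g) :=
      congrArg Subtype.val (Subgroup.mem_center_iff.mp hc ⟨_, hy'⟩)
    calc g * c * g⁻¹ * y = g * (c * (g⁻¹ * y * g)) * g⁻¹ := by group
      _ = y * (g * c * g⁻¹) := by rw [← h2]; group

lemma exists_eq_pow (hL : IsCaminaKernel L e q) {p : ℕ} (hp : p.Prime) (hpq : ∃ l, q = p ^ l) :
    ∃ n, e = p ^ n := by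
  have he := hL.two_le
  have heq := hL.lt
  refine ⟨_, Nat.eq_prime_pow_of_unique_prime_dvd (by omega) fun {r} hr hre => ?_⟩
  by_contra hrp
  have : Fact r.Prime := ⟨hr⟩
  obtain ⟨l, hl⟩ := hpq
  have hcop : r.Coprime q := by
    rw [hl]
    exact ((Nat.coprime_primes hr hp).mpr hrp).pow_right l
  obtain ⟨P⟩ : Nonempty (Sylow r G) := inferInstance
  have hPL : (P : Subgroup G) ⊓ L = ⊥ := by
    refine disjoint_iff.mp (Subgroup.disjoint_of_coprime_natCard ?_)
    rw [hL.card_eq, P.card_eq_multiplicity]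
    exact hcop.pow_left _
  have h1 := hL.card_dvd P hPL
  have hq0 : q - 1 ≠ 0 := by omega
  have he0 : e ≠ 0 := by omega
  rw [P.card_eq_multiplicity, hL.card_group,
    hr.pow_dvd_iff_le_factorization (mul_ne_zero he0 hq0),
    Nat.factorization_mul (mul_ne_zero (pow_ne_zero 2 he0) (by omega)) hq0,
    Nat.factorization_mul (pow_ne_zero 2 he0) (by omega), Nat.factorization_mul he0 hq0,
    Nat.factorization_pow] at h1
  simp only [Finsupp.coe_add, Pi.add_apply, Finsupp.coe_smul, Pi.smul_apply, smul_eq_mul] at h1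
  have h2 : 0 < e.factorization r := hr.factorization_pos_of_dvd he0 hre
  omega

lemma card_centralizer (hL : IsCaminaKernel L e q) {z : G} (hz : z ∈ L) (hz1 : z ≠ 1) :
    Nat.card (Subgroup.centralizer {z}) = e ^ 2 * q := by
  have h1 := card_mul_card_inf_centralizer ⊤ (({g : G | g ∈ L} : Finset G).erase 1) z
    (fun k _ => by
      simp only [mem_erase, mem_filter, mem_univ, true_and, Ne, conj_eq_one_iff]
      exact ⟨hz1, hL.normal.conj_mem z hz k⟩)
    (fun y hy => by
      simp only [mem_erase, mem_filter, mem_univ, true_and] at hy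
      obtain ⟨c, hc⟩ := isConj_iff.mp (hL.isConj z hz hz1 y hy.2 hy.1)
      exact ⟨c, Subgroup.mem_top c, hc⟩)
  rw [Finset.card_erase_of_mem (by simp [L.one_mem]), hL.card_filter_mem, top_inf_eq,
    Subgroup.card_top, hL.card_group, mul_comm] at h1
  have := hL.lt
  exact Nat.eq_of_mul_eq_mul_right (by have := hL.two_le; omega) h1

/-- If the stabilizer of a coset `x L` contains a subgroup acting transitively on it, then the order
of this coset divides the order of this subgroup. -/
lemma card_mul_card_of_transitive (hL : IsCaminaKernel L e q) (H : Subgroup G) (x : G)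
    (hH : ∀ z ∈ L, ∃ h ∈ H, h * x * h⁻¹ = x * z) :
    ∃ D ≤ H, q * Nat.card (H ⊓ Subgroup.centralizer {x} : Subgroup G) = Nat.card D := by
  have := hL.normal
  let D := H ⊓ (Subgroup.centralizer {QuotientGroup.mk' L x}).comap (QuotientGroup.mk' L)
  have hD : ∀ g, g ∈ D ↔ g ∈ H ∧ ∃ z ∈ L, g * x * g⁻¹ = x * z := by
    intro g
    rw [Subgroup.mem_inf, Subgroup.mem_comap, Subgroup.mem_centralizer_singleton_iff,
      ← mul_inv_eq_iff_eq_mul, ← map_mul, ← map_inv, ← map_mul, eq_comm, QuotientGroup.mk'_eq_mk']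
    simp only [eq_comm]
  refine ⟨D, inf_le_left, ?_⟩
  have h1 := card_mul_card_inf_centralizer D (({g : G | g ∈ L} : Finset G).image (x * ·)) x
    (fun k hk => by
      obtain ⟨-, z, hz, h⟩ := (hD k).mp hk
      exact mem_image.mpr ⟨z, by simpa using hz, h.symm⟩)
    (fun y hy => by
      obtain ⟨z, hz, rfl⟩ := mem_image.mp hy
      have hz' : z ∈ L := by simpa using hz
      obtain ⟨h, hh, hhz⟩ := hH z hz'
      exact ⟨h, (hD h).mpr ⟨hh, z, hz', hhz⟩, hhz⟩)
  rw [Finset.card_image_of_injective _ (mul_right_injective x), hL.card_filter_mem] at h1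
  rw [← h1]
  congr 2
  have h2 : (D ⊓ Subgroup.centralizer {x} : Subgroup G) = H ⊓ Subgroup.centralizer {x} := by
    ext g
    simp only [Subgroup.mem_inf, hD]
    constructor
    · rintro ⟨⟨h, -⟩, h'⟩
      exact ⟨h, h'⟩
    · rintro ⟨h, h'⟩
      refine ⟨⟨h, 1, L.one_mem, ?_⟩, h'⟩
      rw [Subgroup.mem_centralizer_singleton_iff.mp h', mul_one]
      group
  rw [h2]

lemma not_dvd (hL : IsCaminaKernel L e q) : ¬ q ∣ e * (q - 1) := by
  intro h
  have he := hL.two_le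
  have heq := hL.lt
  have : q.Coprime (q - 1) := by
    have := Nat.coprime_self_add_left (m := q - 1) (n := 1)
    rw [Nat.sub_add_cancel (by omega)] at this
    rw [this]
    exact Nat.coprime_one_left _
  exact absurd (Nat.le_of_dvd (by omega) (this.dvd_of_dvd_mul_right h)) (by omega)

end IsCaminaKernel
end LargeDegree

namespace LargeDegree
open Finset
open scoped Classical

/-- An element of odd order has a square root among its powers. -/
lemma exists_sq_eq_of_odd_orderOf {G : Type*} [Group G] {u : G} (hu : Odd (orderOf u)) :
    ∃ k : ℕ, (u ^ 2) ^ k = u := by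
  obtain ⟨m, hm⟩ := hu
  refine ⟨m + 1, ?_⟩
  rw [← pow_mul, show 2 * (m + 1) = (2 * m + 1) + 1 by ring, ← hm, pow_succ, pow_orderOf_eq_one,
    one_mul]

/-- Two involutions whose product has odd order are conjugate by a power of this product. -/
lemma exists_pow_conj_involution {G : Type*} [Group G] {s t : G} (hs : s * s = 1) (ht : t * t = 1)
    (hst : Odd (orderOf (s * t))) : ∃ k : ℕ, ((s * t) ^ k)⁻¹ * s * (s * t) ^ k = t := by
  obtain ⟨k, hk⟩ := exists_sq_eq_of_odd_orderOf hst
  refine ⟨k, ?_⟩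
  have hs' : s⁻¹ = s := inv_eq_of_mul_eq_one_left hs
  have ht' : t⁻¹ = t := inv_eq_of_mul_eq_one_left ht
  have h1 : s * ((s * t) ^ k)⁻¹ * s⁻¹ = (s * t) ^ k := by
    rw [← inv_pow, ← conj_pow, mul_inv_rev, hs', ht']
    congr 1
    rw [mul_assoc, mul_assoc, hs, mul_one]
  have h2 : ((s * t) ^ k)⁻¹ * s = s * (s * t) ^ k := by
    conv_rhs => rw [← h1]
    rw [hs', ← mul_assoc, ← mul_assoc, hs, one_mul]
  rw [h2, mul_assoc, ← pow_add, ← two_mul, pow_mul, hk, ← mul_assoc, hs, one_mul]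

namespace IsCaminaKernel
variable {G : Type*} [Group G] [Fintype G] {L : Subgroup G} {e q : ℕ}

lemma exists_mem_ne_one (hL : IsCaminaKernel L e q) : ∃ z ∈ L, z ≠ 1 := by
  have : 1 < Nat.card L := by
    rw [hL.card_eq]; have := hL.two_le; have := hL.lt; omega
  have := Finite.one_lt_card_iff_nontrivial.mp this
  obtain ⟨⟨z, hz⟩, hz1⟩ := exists_ne (1 : L)
  exact ⟨z, hz, fun h => hz1 (Subtype.ext h)⟩

lemma odd_orderOf (hL : IsCaminaKernel L e q) (he : Odd e) (hq : Odd q) {z g : G} (hz : z ∈ L)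
    (hz1 : z ≠ 1) (hg : g * z = z * g) : Odd (orderOf g) := by
  have h1 : orderOf g ∣ e ^ 2 * q := by
    rw [← hL.card_centralizer hz hz1]
    exact Subgroup.orderOf_dvd_natCard _ (Subgroup.mem_centralizer_singleton_iff.mpr hg)
  exact (he.pow.mul hq).of_dvd_nat h1

lemma conj_eq_inv_of_involution (hL : IsCaminaKernel L e q) (he : Odd e) (hq : Odd q) {t : G}
    (ht : t * t = 1) (ht1 : t ≠ 1) {z : G} (hz : z ∈ L) : t * z * t = z⁻¹ := by
  have ht' : t⁻¹ = t := inv_eq_of_mul_eq_one_left ht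
  have hz' : t * z * t ∈ L := by
    have := hL.normal.conj_mem z hz t
    rwa [ht'] at this
  by_contra h
  have hw1 : z * (t * z * t) ≠ 1 := fun h' => h (eq_inv_of_mul_eq_one_right h')
  have h2 : t * (z * (t * z * t)) = z * (t * z * t) * t := by
    calc t * (z * (t * z * t)) = (t * z * t) * z * t := by group
      _ = z * (t * z * t) * t := by rw [hL.isMulCommutative hz' hz]
  have h3 := hL.odd_orderOf he hq (L.mul_mem hz hz') hw1 h2
  have h4 : orderOf t = 2 := orderOf_eq_prime (by rw [pow_two, ht]) ht1
  rw [h4] at h3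
  exact absurd h3 (by decide)

/-- The parameters `e` and `q` of `IsCaminaKernel` cannot both be odd. -/
lemma not_odd (hL : IsCaminaKernel L e q) (he : Odd e) (hq : Odd q) : False := by
  have he2 := hL.two_le
  have heq := hL.lt
  have hnorm := hL.normal
  obtain ⟨z₀, hz₀, hz₀1⟩ := hL.exists_mem_ne_one
  set T : Finset G := {t : G | t * t = 1 ∧ t ≠ 1} with hT
  have hTmem : ∀ t, t ∈ T ↔ t * t = 1 ∧ t ≠ 1 := by simp [hT]
  have hinv := fun t (ht : t ∈ T) z (hz : z ∈ L) =>
    hL.conj_eq_inv_of_involution he hq ((hTmem t).mp ht).1 ((hTmem t).mp ht).2 hz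
  have hself := fun t (ht : t ∈ T) => inv_eq_of_mul_eq_one_left ((hTmem t).mp ht).1
  have hcent : ∀ s ∈ T, ∀ t ∈ T, ∀ z ∈ L, s * t * z = z * (s * t) := by
    intro s hs t ht z hz
    have h1 := hinv t ht z hz
    have h2 := hinv s hs z⁻¹ (L.inv_mem hz)
    rw [inv_inv, ← h1] at h2
    calc s * t * z = (s * (t * z * t) * s) * s⁻¹ * t⁻¹ := by group
      _ = z * (s * t) := by rw [h2, hself s hs, hself t ht, mul_assoc]
  have hodd : ∀ s ∈ T, ∀ t ∈ T, Odd (orderOf (s * t)) := fun s hs t ht =>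
    hL.odd_orderOf he hq hz₀ hz₀1 (hcent s hs t ht z₀ hz₀)
  have hpow := fun s (hs : s ∈ T) t (ht : t ∈ T) => exists_pow_conj_involution
    ((hTmem s).mp hs).1 ((hTmem t).mp ht).1 (hodd s hs t ht)
  have hTconj : ∀ t ∈ T, ∀ g : G, g * t * g⁻¹ ∈ T := by
    intro t ht g
    rw [hTmem] at ht ⊢
    refine ⟨?_, by rw [Ne, conj_eq_one_iff]; exact ht.2⟩
    calc g * t * g⁻¹ * (g * t * g⁻¹) = g * (t * t) * g⁻¹ := by group
      _ = 1 := by rw [ht.1]; group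
  have hsq : ∀ g : G, g ^ 2 ∈ L → g ^ 2 ≠ 1 → g ∈ L := by
    intro g hg hg1
    obtain ⟨k, hk⟩ := exists_sq_eq_of_odd_orderOf
      (hL.odd_orderOf he hq hg hg1 ((Commute.refl g).pow_right 2))
    rw [← hk]
    exact L.pow_mem hg k
  have hsq' : ∀ g ∈ L, g ^ 2 = 1 → g = 1 := by
    intro g hg hg1
    by_contra h
    have h3 := hL.odd_orderOf he hq hg h rfl
    rw [orderOf_eq_prime hg1 h] at h3
    exact absurd h3 (by decide)
  have hcard1 : #{g : G | g ^ 2 = 1} = #T + 1 := by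
    rw [← Finset.card_insert_of_notMem (s := T) (a := 1) (by simp [hTmem])]
    congr 1
    ext g
    simp only [mem_filter, mem_univ, true_and, mem_insert, hTmem, pow_two]
    by_cases h : g = 1 <;> simp [h]
  have hcard2 : #{g : G | g ^ 2 ∈ L} + 1 = #{g : G | g ^ 2 = 1} + q := by
    have h1 : ({g : G | g ^ 2 ∈ L} : Finset G) =
        ({g : G | g ^ 2 = 1} : Finset G) ∪ ({g : G | g ∈ L} : Finset G) := by
      ext g
      simp only [mem_filter, mem_univ, true_and, mem_union]
      constructor
      · intro h
        by_cases h' : g ^ 2 = 1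
        · exact Or.inl h'
        · exact Or.inr (hsq g h h')
      · rintro (h | h)
        · rw [h]; exact L.one_mem
        · exact L.pow_mem h 2
    have h2 : ({g : G | g ^ 2 = 1} : Finset G) ∩ ({g : G | g ∈ L} : Finset G) = {1} := by
      ext g
      simp only [mem_filter, mem_univ, true_and, mem_inter, mem_singleton]
      constructor
      · rintro ⟨h, h'⟩
        exact hsq' g h' h
      · rintro rfl
        exact ⟨one_pow 2, L.one_mem⟩
    rw [h1, ← hL.card_filter_mem, ← Finset.card_union_add_card_inter, h2, card_singleton]
  have hTcard : #T = e * q := by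
    have h1 := hL.card_sq
    have h2 : ((#{g : G | g ^ 2 ∈ L} : ℕ) : ℤ) + 1 = #{g : G | g ^ 2 = 1} + q := by
      exact_mod_cast hcard2
    have h3 : ((#{g : G | g ^ 2 = 1} : ℕ) : ℤ) = #T + 1 := by exact_mod_cast hcard1
    have hq1 : (0 : ℤ) < q - 1 := by
      have : (e : ℤ) < q := by exact_mod_cast heq
      have : (2 : ℤ) ≤ e := by exact_mod_cast he2
      linarith
    rw [h3] at h1 h2
    have h4 : ((#{g : G | g ^ 2 ∈ L} : ℕ) : ℤ) = #T + q := by linarith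
    rw [h4] at h1
    rcases h1 with h1 | h1
    · have : ((#T : ℕ) : ℤ) * (q - 1) = e * q * (q - 1) := by linarith
      exact_mod_cast mul_right_cancel₀ hq1.ne' this
    · exfalso
      have h5 : ((#T : ℕ) : ℤ) * (q - 1) = - (e * q) * (q - 1) := by linarith
      have h6 := mul_right_cancel₀ hq1.ne' h5
      have : (0 : ℤ) < e * q := by
        exact_mod_cast Nat.mul_pos (by omega : 0 < e) (by omega : 0 < q)
      have : (0 : ℤ) ≤ (#T : ℕ) := Int.natCast_nonneg _
      linarith
  have hTpos : 0 < #T := by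
    rw [hTcard]; exact Nat.mul_pos (by omega) (by omega)
  obtain ⟨t, ht⟩ := Finset.card_pos.mp hTpos
  have hcentcard : Nat.card (Subgroup.centralizer {t}) = e * (q - 1) := by
    have h1 := card_mul_card_inf_centralizer ⊤ T t (fun k _ => hTconj t ht k)
      (fun s hs => by
        obtain ⟨k, hk⟩ := hpow t ht s hs
        exact ⟨((t * s) ^ k)⁻¹, Subgroup.mem_top _, by rw [inv_inv, hk]⟩)
    rw [top_inf_eq, Subgroup.card_top, hL.card_group, hTcard] at h1
    apply Nat.eq_of_mul_eq_mul_left (hTcard ▸ hTpos)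
    rw [h1]; ring
  obtain ⟨s, hs, hts⟩ : ∃ s ∈ T, t * s ∉ L := by
    by_contra! h
    have h1 : #T ≤ #{g : G | g ∈ L} :=
      Finset.card_le_card_of_injOn (t * ·) (fun s hs => by simpa using h s hs)
        (fun _ _ _ _ h => mul_left_cancel h)
    rw [hL.card_filter_mem, hTcard] at h1
    nlinarith
  obtain ⟨D, hDH, hD⟩ := hL.card_mul_card_of_transitive (Subgroup.centralizer {t}) (t * s) (by
    intro z hz
    obtain ⟨g, hg⟩ := isConj_iff.mp (hL.isConj_mul _ hts z hz)
    set y := t * s * z with hy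
    have htt := ((hTmem t).mp ht).1
    have hty : t * y * t⁻¹ = y⁻¹ := by
      have h1 : t * (z * (t * s)) * t⁻¹ = (t * z * t) * (s * t) := by
        rw [hself t ht]; group
      rw [hy, hcent t ht s hs z hz, h1, hinv t ht z hz,
        ← hcent s hs t ht _ (L.inv_mem hz), mul_inv_rev z, mul_inv_rev t, hself t ht, hself s hs]
    have htx : t * (t * s) * t⁻¹ = (t * s)⁻¹ := by
      rw [mul_inv_rev, hself t ht, hself s hs, ← mul_assoc, htt, one_mul]
    set r := g * t * g⁻¹ with hr
    have hrT : r ∈ T := hTconj t ht g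
    have hry : r * y * r⁻¹ = y⁻¹ := by
      rw [hr, ← hg]
      calc g * t * g⁻¹ * (g * (t * s) * g⁻¹) * (g * t * g⁻¹)⁻¹
          = g * (t * (t * s) * t⁻¹) * g⁻¹ := by group
        _ = _ := by rw [htx]; group
    have hcomm : Commute (r * t) y := by
      have : r * t * y * (r * t)⁻¹ = y := by
        calc r * t * y * (r * t)⁻¹ = r * (t * y * t⁻¹) * r⁻¹ := by group
          _ = (r * y * r⁻¹)⁻¹ := by rw [hty]; group
          _ = y := by rw [hry, inv_inv]
      exact mul_inv_eq_iff_eq_mul.mp this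
    obtain ⟨k, hk⟩ := hpow r hrT t ht
    refine ⟨((r * t) ^ k)⁻¹ * g, ?_, ?_⟩
    · rw [Subgroup.mem_centralizer_singleton_iff, ← mul_inv_eq_iff_eq_mul]
      refine Eq.trans ?_ hk
      rw [hr]
      group
    · calc ((r * t) ^ k)⁻¹ * g * (t * s) * (((r * t) ^ k)⁻¹ * g)⁻¹
          = ((r * t) ^ k)⁻¹ * (g * (t * s) * g⁻¹) * (r * t) ^ k := by group
        _ = y := by rw [hg, mul_assoc, ← (hcomm.pow_left k).eq, inv_mul_cancel_left])
  refine hL.not_dvd ?_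
  rw [← hcentcard]
  exact (Dvd.intro _ hD).trans (Subgroup.card_dvd_of_le hDH)

end IsCaminaKernel
end LargeDegree

namespace LargeDegree
open Subgroup

/-- If `D ≠ X ∩ S` consists of elements of a conjugation invariant subset `X` lying in a `p`-subgroup
`S`, then the normalizer of `D` in `S` contains an element of `X ∩ S` outside `D`. -/
lemma exists_mem_normalizer_closure {G : Type*} [Group G] [Finite G] {p : ℕ} [Fact p.Prime]
    {X D : Set G} (hX : ∀ x ∈ X, ∀ g : G, g * x * g⁻¹ ∈ X) {S : Subgroup G} (hS : IsPGroup p S)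
    (hDX : D ⊆ X) (hDS : D ⊆ S) (hlt : ∃ x ∈ X, x ∈ S ∧ x ∉ closure D) :
    ∃ x ∈ X, x ∈ S ∧ x ∉ closure D ∧ x ∈ normalizer (closure D : Set G) := by
  obtain ⟨x, hxX, hxS, hxD⟩ := hlt
  set J := closure D
  have hJS : J ≤ S := (closure_le S).mpr hDS
  by_cases h : S ≤ normalizer (J : Set G)
  · exact ⟨x, hxX, hxS, hxD, h hxS⟩
  have := hS.isNilpotent
  have hM : (normalizer (J : Set G)).subgroupOf S < ⊤ := by
    rw [lt_top_iff_ne_top, Ne, subgroupOf_eq_top]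
    exact h
  obtain ⟨⟨g, hgS⟩, hg, hg'⟩ := SetLike.exists_of_lt (Group.normalizerCondition_of_isNilpotent _ hM)
  rw [mem_subgroupOf] at hg'
  obtain ⟨d, hdD, hd⟩ : ∃ d ∈ D, g * d * g⁻¹ ∉ J := by
    by_contra! hall
    refine hg' (mem_normalizer_fintype fun n hn => ?_)
    have h1 : J ≤ J.comap (MulAut.conj g).toMonoidHom :=
      (closure_le _).mpr fun d hd => by simpa using hall d hd
    simpa using h1 hn
  have hdS := hDS hdD
  refine ⟨g * d * g⁻¹, hX d (hDX hdD) g, S.mul_mem (S.mul_mem hgS hdS) (S.inv_mem hgS), hd, ?_⟩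
  have h1 : (⟨d, hdS⟩ : S) ∈ (normalizer (J : Set G)).subgroupOf S :=
    mem_subgroupOf.mpr (le_normalizer (subset_closure hdD))
  exact mem_subgroupOf.mp ((mem_normalizer_iff.mp hg _).mp h1)

/-- A weak form of the **Baer–Suzuki theorem**: if any two elements of a conjugation invariant set
lie in a common `p`-subgroup, then this set is contained in every Sylow `p`-subgroup. -/
lemma subset_sylow_of_forall_pair {G : Type*} [Group G] [Finite G] {p : ℕ} [Fact p.Prime]
    {X : Set G} (hX : ∀ x ∈ X, ∀ g : G, g * x * g⁻¹ ∈ X)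
    (hpair : ∀ x ∈ X, ∀ y ∈ X, ∃ P : Subgroup G, IsPGroup p P ∧ x ∈ P ∧ y ∈ P) (S : Sylow p G) :
    X ⊆ S := by
  suffices hall : ∀ S T : Sylow p G, X ∩ S = X ∩ T by
    intro x hx
    obtain ⟨P, hP, hxP, -⟩ := hpair x hx x hx
    obtain ⟨T, hT⟩ := hP.exists_le_sylow
    have : x ∈ X ∩ S := by
      rw [hall S T]
      exact ⟨hx, hT hxP⟩
    exact this.2
  by_contra! hne
  obtain ⟨S₀, T₀, h₀⟩ := hne
  have : Nonempty {P : Sylow p G × Sylow p G // X ∩ P.1 ≠ X ∩ P.2} := ⟨⟨(S₀, T₀), h₀⟩⟩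
  obtain ⟨⟨⟨S₁, S₂⟩, h12⟩, hmax⟩ := Finite.exists_max
    (fun P : {P : Sylow p G × Sylow p G // X ∩ P.1 ≠ X ∩ P.2} =>
      (X ∩ P.1.1 ∩ P.1.2 : Set G).ncard)
  have hmax' : ∀ P Q : Sylow p G, (X ∩ S₁ ∩ S₂ : Set G).ncard < (X ∩ P ∩ Q : Set G).ncard →
      X ∩ P = (X ∩ Q : Set G) := by
    intro P Q h
    by_contra h'
    exact absurd (hmax ⟨(P, Q), h'⟩) (not_le.mpr h)
  have hcard : (X ∩ S₁ : Set G).ncard = (X ∩ S₂ : Set G).ncard := by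
    have hle : ∀ S T : Sylow p G, (X ∩ S : Set G).ncard ≤ (X ∩ T : Set G).ncard := by
      intro S T
      obtain ⟨g, rfl⟩ := MulAction.exists_smul_eq G S T
      refine Set.ncard_le_ncard_of_injOn (fun x => g * x * g⁻¹) ?_ ?_
      · rintro x ⟨hxX, hxS⟩
        refine ⟨hX x hxX g, ?_⟩
        rw [Sylow.coe_smul]
        exact Set.smul_mem_smul_set (a := MulAut.conj g) hxS
      · intro x _ y _ h
        exact mul_left_cancel (mul_right_cancel h)
    exact le_antisymm (hle _ _) (hle _ _)
  set D : Set G := X ∩ S₁ ∩ S₂ with hD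
  have hnot : ∀ x ∈ X, x ∈ S₁ → x ∈ S₂ → x ∈ D := fun x h h1 h2 => ⟨⟨h, h1⟩, h2⟩
  have hDX : D ⊆ X := fun x hx => hx.1.1
  have hDS₁ : D ⊆ (S₁ : Subgroup G) := fun x hx => hx.1.2
  have hDS₂ : D ⊆ (S₂ : Subgroup G) := fun x hx => hx.2
  have hex₁ : ∃ x ∈ X, x ∈ (S₁ : Subgroup G) ∧ x ∉ closure D := by
    by_contra! h
    refine h12 (Set.eq_of_subset_of_ncard_le ?_ hcard.ge)
    exact fun x hx => ⟨hx.1, (closure_le _).mpr hDS₂ (h x hx.1 hx.2)⟩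
  have hex₂ : ∃ x ∈ X, x ∈ (S₂ : Subgroup G) ∧ x ∉ closure D := by
    by_contra! h
    refine h12 (Set.eq_of_subset_of_ncard_le ?_ hcard.le).symm
    exact fun x hx => ⟨hx.1, (closure_le _).mpr hDS₁ (h x hx.1 hx.2)⟩
  obtain ⟨x₁, hx₁X, hx₁S, hx₁D, hx₁N⟩ :=
    exists_mem_normalizer_closure hX S₁.isPGroup' hDX hDS₁ hex₁
  obtain ⟨x₂, hx₂X, hx₂S, hx₂D, hx₂N⟩ :=
    exists_mem_normalizer_closure hX S₂.isPGroup' hDX hDS₂ hex₂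
  obtain ⟨P, hP, hx₁P, hx₂P⟩ := hpair x₁ hx₁X x₂ hx₂X
  have hJ : IsPGroup p (closure D) := S₁.isPGroup'.to_le ((closure_le _).mpr hDS₁)
  have hQ : IsPGroup p (closure D ⊔ (P ⊓ normalizer (closure D : Set G)) : Subgroup G) :=
    hJ.to_sup_of_normal_left' hP.to_inf_left inf_le_right
  obtain ⟨T, hT⟩ := hQ.exists_le_sylow
  have hDT : D ⊆ T := fun x hx => hT (mem_sup_left (subset_closure hx))
  have hx₁T : x₁ ∈ T := hT (mem_sup_right ⟨hx₁P, hx₁N⟩)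
  have hx₂T : x₂ ∈ T := hT (mem_sup_right ⟨hx₂P, hx₂N⟩)
  have h1 : X ∩ S₁ = (X ∩ T : Set G) := by
    refine hmax' S₁ T (Set.ncard_lt_ncard ((Set.ssubset_iff_of_subset ?_).mpr ?_))
    · exact fun x hx => ⟨⟨hDX hx, hDS₁ hx⟩, hDT hx⟩
    · exact ⟨x₁, ⟨⟨hx₁X, hx₁S⟩, hx₁T⟩, fun h => hx₁D (subset_closure h)⟩
  have h2 : X ∩ S₂ = (X ∩ T : Set G) := by
    refine hmax' S₂ T (Set.ncard_lt_ncard ((Set.ssubset_iff_of_subset ?_).mpr ?_))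
    · exact fun x hx => ⟨⟨hDX hx, hDS₂ hx⟩, hDT hx⟩
    · exact ⟨x₂, ⟨⟨hx₂X, hx₂S⟩, hx₂T⟩, fun h => hx₂D (subset_closure h)⟩
  exact h12 (h1.trans h2.symm)

end LargeDegree

namespace LargeDegree
open Finset
open scoped Classical

namespace IsCaminaKernel
variable {G : Type*} [Group G] [Fintype G] {L : Subgroup G} {e q : ℕ}

/-- If `L` has exponent two, `g` squares into `L` and does not centralize `L`, then more than the
square root of the elements of `L` commute with `g`. -/
lemma card_lt_sq_card_centralizer (hL : IsCaminaKernel L e q) (h2 : ∀ z ∈ L, z * z = 1) {g : G}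
    (hg : g * g ∈ L) (hgC : g ∉ Subgroup.centralizer (L : Set G)) :
    q < Nat.card (L ⊓ Subgroup.centralizer {g} : Subgroup G) ^ 2 := by
  have hnorm := hL.normal
  have hcomm : ∀ {x y : G}, x ∈ L → y ∈ L → x * y = y * x := hL.isMulCommutative
  have hgL : g ∉ L := fun h => hgC (Subgroup.mem_centralizer_iff.mpr fun z hz => hcomm hz h)
  have hconj : ∀ {z : G}, z ∈ L → g * z * g⁻¹ ∈ L := fun hz => hnorm.conj_mem _ hz g
  let φ : L →* G :=
    { toFun := fun z => z * (g * z * g⁻¹)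
      map_one' := by simp
      map_mul' := fun a b => by
        have := hcomm b.2 (hconj a.2)
        simp only [Subgroup.coe_mul]
        calc (a : G) * b * (g * (a * b) * g⁻¹) = a * (b * (g * a * g⁻¹)) * (g * b * g⁻¹) := by group
          _ = a * (g * a * g⁻¹) * (b * (g * b * g⁻¹)) := by rw [this]; group }
  have hφ : ∀ z : L, φ z = z * (g * z * g⁻¹) := fun _ => rfl
  have hrange : φ.range ≤ L ⊓ Subgroup.centralizer {g} := by
    rintro _ ⟨z, rfl⟩
    rw [hφ]
    refine Subgroup.mem_inf.mpr ⟨L.mul_mem z.2 (hconj z.2),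
      Subgroup.mem_centralizer_singleton_iff.mpr ?_⟩
    have h3 := hcomm hg z.2
    have h4 := hcomm z.2 (hconj z.2)
    symm
    calc g * (z * (g * z * g⁻¹)) = (g * z * g⁻¹) * (g * g * z) * g⁻¹ := by group
      _ = (g * z * g⁻¹) * z * g := by rw [h3]; group
      _ = _ := by rw [← h4]
  have hker : φ.ker.map L.subtype = L ⊓ Subgroup.centralizer {g} := by
    ext z
    simp only [Subgroup.mem_map, MonoidHom.mem_ker, Subgroup.mem_inf, Subgroup.coe_subtype,
      Subgroup.mem_centralizer_singleton_iff, hφ]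
    constructor
    · rintro ⟨w, hw, rfl⟩
      refine ⟨w.2, ?_⟩
      have h3 : g * w * g⁻¹ = w := by
        rw [eq_inv_of_mul_eq_one_right hw]
        exact inv_eq_of_mul_eq_one_left (h2 _ w.2)
      exact (mul_inv_eq_iff_eq_mul.mp h3).symm
    · rintro ⟨hz, hzg⟩
      refine ⟨⟨z, hz⟩, ?_, rfl⟩
      simp only
      rw [← hzg, mul_inv_cancel_right, h2 z hz]
  have hnot : g * g ∉ φ.range := by
    rintro ⟨z, hz⟩
    rw [hφ] at hz
    have h3 : (g * z) * (g * z) = 1 := by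
      have h4 := hcomm z.2 (hconj z.2)
      calc g * z * (g * z) = (g * z * g⁻¹) * (g * g * z) := by group
        _ = (g * z * g⁻¹ * z) * (g * g) := by rw [hcomm hg z.2]; group
        _ = 1 := by rw [← h4, hz, h2 _ hg]
    have hsq : ∀ w ∈ L, (g * w) * (g * w) = 1 := by
      intro w hw
      obtain ⟨c, hc⟩ := isConj_iff.mp ((hL.isConj_mul g hgL z z.2).symm.trans
        (hL.isConj_mul g hgL w hw))
      rw [← hc]
      calc c * (g * z) * c⁻¹ * (c * (g * z) * c⁻¹) = c * ((g * z) * (g * z)) * c⁻¹ := by group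
        _ = 1 := by rw [h3]; group
    refine hgC (Subgroup.mem_centralizer_iff.mpr fun w hw => ?_)
    have h4 := hsq 1 L.one_mem
    rw [mul_one] at h4
    calc w * g = (w * w) * (w⁻¹ * g⁻¹) * (g * g) := by group
      _ = (g * w)⁻¹ := by rw [h2 w hw, h4, one_mul, mul_one, mul_inv_rev]
      _ = g * w := inv_eq_of_mul_eq_one_left (hsq w hw)
  have hlt : φ.range < L ⊓ Subgroup.centralizer {g} := by
    refine lt_of_le_of_ne hrange fun h => hnot ?_
    rw [h]
    exact ⟨hg, Subgroup.mem_centralizer_singleton_iff.mpr (mul_assoc g g g)⟩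
  have hcard1 : Nat.card φ.range < Nat.card (L ⊓ Subgroup.centralizer {g} : Subgroup G) :=
    Set.ncard_lt_ncard (SetLike.coe_ssubset_coe.mpr hlt)
  have hcard2 : Nat.card φ.ker = Nat.card (L ⊓ Subgroup.centralizer {g} : Subgroup G) := by
    rw [← hker]
    exact (Subgroup.card_map_of_injective L.subtype_injective).symm
  have hcard3 : Nat.card φ.ker * Nat.card φ.range = q := by
    rw [← hL.card_eq, ← Subgroup.card_mul_index φ.ker, Subgroup.index_ker]
  rw [← hcard3, hcard2, pow_two]
  exact Nat.mul_lt_mul_of_pos_left hcard1 Nat.card_pos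

/-- If `L` is a `2`-group, then it is centralized by every element squaring into it. -/
lemma mem_centralizer_of_sq_mem (hL : IsCaminaKernel L e q) (h2 : ∀ z ∈ L, z * z = 1)
    (hq : ∃ l, q = 2 ^ l) (he : ∃ n, e = 2 ^ n) {g : G} (hg : g * g ∈ L) :
    g ∈ Subgroup.centralizer (L : Set G) := by
  have hnorm := hL.normal
  obtain ⟨l, hl⟩ := hq
  obtain ⟨n, hn⟩ := he
  set X : Set G := {g | g * g ∈ L ∧ g ∉ Subgroup.centralizer (L : Set G)} with hX
  by_contra hgC
  have hgX : g ∈ X := ⟨hg, hgC⟩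
  have hXconj : ∀ x ∈ X, ∀ g : G, g * x * g⁻¹ ∈ X := by
    rintro x ⟨hx, hxC⟩ g
    refine ⟨?_, fun h => hxC ?_⟩
    · have := hnorm.conj_mem _ hx g
      rwa [show g * x * g⁻¹ * (g * x * g⁻¹) = g * (x * x) * g⁻¹ by group]
    · have h3 : (Subgroup.centralizer (L : Set G)).Normal := inferInstance
      have h4 := h3.conj_mem _ h g⁻¹
      rwa [show g⁻¹ * (g * x * g⁻¹) * g⁻¹⁻¹ = x by group] at h4
  have hpair : ∀ x ∈ X, ∀ y ∈ X, ∃ P : Subgroup G, IsPGroup 2 P ∧ x ∈ P ∧ y ∈ P := by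
    rintro x ⟨hx, hxC⟩ y ⟨hy, hyC⟩
    have hx2 := hL.card_lt_sq_card_centralizer h2 hx hxC
    have hy2 := hL.card_lt_sq_card_centralizer h2 hy hyC
    obtain ⟨z, hz, hz1⟩ : ∃ z ∈ (L ⊓ Subgroup.centralizer {x}) ⊓ (L ⊓ Subgroup.centralizer {y}),
        z ≠ 1 := by
      by_contra! hall
      have hbot := (Subgroup.eq_bot_iff_forall _).mpr hall
      have h3 := Subgroup.mul_injective_of_disjoint (disjoint_iff.mpr hbot)
      have h4 := Nat.card_le_card_of_injective
        (fun a : (L ⊓ Subgroup.centralizer {x} : Subgroup G) ×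
          (L ⊓ Subgroup.centralizer {y} : Subgroup G) =>
          (⟨a.1 * a.2, L.mul_mem a.1.2.1 a.2.2.1⟩ : L))
        (fun a b h => h3 (congrArg Subtype.val h))
      rw [Nat.card_prod, hL.card_eq] at h4
      have h5 := Nat.mul_lt_mul'' hx2 hy2
      rw [← mul_pow, ← pow_two] at h5
      exact absurd (Nat.pow_le_pow_left h4 2) (not_le.mpr h5)
    simp only [Subgroup.mem_inf, Subgroup.mem_centralizer_singleton_iff] at hz
    refine ⟨Subgroup.centralizer {z}, IsPGroup.of_card (n := n * 2 + l) ?_, ?_, ?_⟩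
    · rw [hL.card_centralizer hz.1.1 hz1, hn, hl, pow_add, pow_mul]
    · exact Subgroup.mem_centralizer_singleton_iff.mpr hz.1.2.symm
    · exact Subgroup.mem_centralizer_singleton_iff.mpr hz.2.2.symm
  obtain ⟨S⟩ : Nonempty (Sylow 2 G) := inferInstance
  have hXS := subset_sylow_of_forall_pair hXconj hpair S
  let _ : MulAction S L := MulAction.compHom L ((MulAut.conjNormal (H := L)).comp S.1.subtype)
  have hsmul : ∀ (s : S) (z : L), ((s • z : L) : G) = s * z * (s : G)⁻¹ := fun s z =>
    MulAut.conjNormal_apply (s : G) z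
  have hq2 : 2 ∣ Nat.card L := by
    rw [hL.card_eq, hl]
    refine dvd_pow_self 2 ?_
    rintro rfl
    have := hL.lt
    have := hL.two_le
    omega
  have h1fix : (1 : L) ∈ MulAction.fixedPoints S L := fun s => Subtype.ext (by rw [hsmul]; simp)
  obtain ⟨z, hz, hz1⟩ := S.2.exists_fixed_point_of_prime_dvd_card_of_fixed_point L hq2 h1fix
  have hz1' : (z : G) ≠ 1 := fun h => hz1 (Subtype.ext h).symm
  have hcz : ∀ x ∈ X, x * z * x⁻¹ = z := fun x hx => by
    rw [← hsmul ⟨x, hXS hx⟩ z, hz ⟨x, hXS hx⟩]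
  refine hgC (Subgroup.mem_centralizer_iff.mpr fun w hw => ?_)
  by_cases hw1 : w = 1
  · rw [hw1, one_mul, mul_one]
  · obtain ⟨c, rfl⟩ := isConj_iff.mp (hL.isConj z z.2 hz1' w hw hw1)
    have h3 := hcz _ (hXconj g hgX c⁻¹)
    symm
    rw [← mul_inv_eq_iff_eq_mul]
    nth_rewrite 2 [← h3]
    group

end IsCaminaKernel
end LargeDegree

namespace LargeDegree
open Finset
open scoped Classical

namespace IsCaminaKernel
variable {G : Type*} [Group G] [Fintype G] {L : Subgroup G} {e q : ℕ}

/-- The size of a set which is invariant under left multiplication by `L` is divisible by `q`. -/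
lemma dvd_sum_of_mul_left (hL : IsCaminaKernel L e q) (s : Finset G)
    (hs : ∀ z ∈ L, ∀ w ∈ s, z * w ∈ s) {F : G → ℤ} (hF : ∀ z ∈ L, ∀ w ∈ s, F (z * w) = F w) :
    (q : ℤ) ∣ ∑ w ∈ s, F w := by
  rw [← hL.card_eq, Nat.card_eq_fintype_card]
  refine card_dvd_sum_of_invariant (MulAction.toPermHom L G) s (fun z w hw => hs z z.2 w hw)
    (fun z w hw => hF z z.2 w hw) fun w _ _ z h => ?_
  have h3 : (z : G) * w = w := h
  exact Subtype.ext (mul_eq_right.mp h3)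

/-- The parameters `e` and `q` of `IsCaminaKernel` cannot both be powers of two. -/
lemma not_two_pow (hL : IsCaminaKernel L e q) (h2 : ∀ z ∈ L, z * z = 1)
    (hq : ∃ l, q = 2 ^ l) (he : ∃ n, e = 2 ^ n) : False := by
  have he2 := hL.two_le
  have heq := hL.lt
  have hnorm := hL.normal
  have hq0 : 0 < q := by omega
  set C := Subgroup.centralizer (L : Set G) with hC
  have hCmem : ∀ g, g * g ∈ L → g ∈ C := fun g => hL.mem_centralizer_of_sq_mem h2 hq he
  have hcomm : ∀ w ∈ C, ∀ z ∈ L, z * w = w * z := fun w hw z hz =>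
    Subgroup.mem_centralizer_iff.mp hw z hz
  have hLC : L ≤ C := fun z hz => Subgroup.mem_centralizer_iff.mpr fun w hw =>
    hL.isMulCommutative hw hz
  have hsqmul : ∀ w ∈ C, ∀ z ∈ L, (z * w) * (z * w) = w * w := by
    intro w hw z hz
    calc z * w * (z * w) = z * (w * z) * w := by group
      _ = w * w := by rw [← hcomm w hw z hz, ← mul_assoc, h2 z hz, one_mul]
  -- the order of `C`
  obtain ⟨z₀, hz₀, hz₀1⟩ := hL.exists_mem_ne_one
  obtain ⟨c, hc⟩ : q ∣ Nat.card C := hL.card_eq ▸ Subgroup.card_dvd_of_le hLC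
  have hcdvd : c ∣ e ^ 2 := by
    have h1 : C ≤ Subgroup.centralizer {z₀} := fun w hw =>
      Subgroup.mem_centralizer_singleton_iff.mpr (hcomm w hw z₀ hz₀).symm
    have h3 := Subgroup.card_dvd_of_le h1
    rw [hc, hL.card_centralizer hz₀ hz₀1, mul_comm] at h3
    exact Nat.dvd_of_mul_dvd_mul_right hq0 h3
  -- the square root count
  set N := #{g : G | g ^ 2 = 1}
  set M := #{g : G | g ^ 2 ∈ L}
  set R := #{g : G | g ∈ C ∧ g * g ∉ L} with hR
  have hcardC : Nat.card C = #{g : G | g ∈ C} := Nat.subtype_card _ (by simp)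
  have hMR : M + R = Nat.card C := by
    rw [hcardC, ← Finset.card_filter_add_card_filter_not (s := {g : G | g ∈ C}) (fun g => g * g ∈ L),
      Finset.filter_filter, Finset.filter_filter]
    congr 1
    refine congrArg Finset.card (Finset.ext fun g => ?_)
    simp only [mem_filter, mem_univ, true_and, pow_two]
    exact ⟨fun h => ⟨hCmem g h, h⟩, fun h => h.2⟩
  have hNM : N ≤ M := Finset.card_le_card fun g hg => by
    simp only [mem_filter, mem_univ, true_and] at hg ⊢
    rw [hg]; exact L.one_mem
  have hNC : N ≤ Nat.card C := by omega
  have hNpos : 1 ≤ N := Finset.card_pos.mpr ⟨1, by simp⟩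
  obtain ⟨a, ha⟩ : (q : ℤ) ∣ (N : ℕ) := by
    have h1 := hL.dvd_sum_of_mul_left ({g : G | g ^ 2 = 1} : Finset G) (F := fun _ => 1)
      (fun z hz w hw => by
        simp only [mem_filter, mem_univ, true_and, pow_two] at hw ⊢
        rw [hsqmul w (hCmem w (hw ▸ L.one_mem)) z hz, hw]) (fun _ _ _ _ => rfl)
    simpa using h1
  obtain ⟨b, hb⟩ : (q : ℤ) * q ∣ (R : ℕ) := by
    have h1 : ∀ y, (q : ℤ) ∣ (#{g : G | g ∈ C ∧ g * g = y} : ℕ) := by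
      intro y
      have h1 := hL.dvd_sum_of_mul_left ({g : G | g ∈ C ∧ g * g = y} : Finset G) (F := fun _ => 1)
        (fun z hz w hw => by
          simp only [mem_filter, mem_univ, true_and] at hw ⊢
          exact ⟨C.mul_mem (hLC hz) hw.1, (hsqmul w hw.1 z hz).trans hw.2⟩) (fun _ _ _ _ => rfl)
      simpa using h1
    choose r hr using h1
    have h3 : (R : ℤ) = ∑ y ∈ ({y : G | y ∉ L} : Finset G), (q : ℤ) * r y := by
      rw [hR, Finset.card_eq_sum_card_fiberwise (f := fun g => g * g)
        (t := ({y : G | y ∉ L} : Finset G)) (fun g hg => by simpa using (mem_filter.mp hg).2.2)]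
      push_cast
      refine Finset.sum_congr rfl fun y hy => ?_
      rw [← hr, Finset.filter_filter]
      congr 3
      ext g
      have hy' : y ∉ L := (mem_filter.mp hy).2
      constructor
      · rintro ⟨⟨h, -⟩, h'⟩; exact ⟨h, h'⟩
      · rintro ⟨h, h'⟩; exact ⟨⟨h, h'.symm ▸ hy'⟩, h'⟩
    rw [h3, ← Finset.mul_sum]
    refine mul_dvd_mul_left _ (hL.dvd_sum_of_mul_left _ (fun z hz y hy => ?_) fun z hz y hy => ?_)
    · simp only [mem_filter, mem_univ, true_and] at hy ⊢
      exact fun h => hy ((L.mul_mem_cancel_left hz).mp h)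
    · have hy' : y ∉ L := (mem_filter.mp hy).2
      have hz' : y⁻¹ * z * y ∈ L := by
        have := hnorm.conj_mem z hz y⁻¹
        rwa [inv_inv] at this
      obtain ⟨g, hg⟩ := isConj_iff.mp (hL.isConj_mul y hy' _ hz')
      have hg' : g * y * g⁻¹ = z * y := by rw [hg]; group
      have hCn : C.Normal := inferInstance
      have h4 : #{w : G | w ∈ C ∧ w * w = y} = #{w : G | w ∈ C ∧ w * w = z * y} := by
        refine Finset.card_bij (fun w _ => g * w * g⁻¹) ?_ ?_ ?_
        · intro w hw
          simp only [mem_filter, mem_univ, true_and] at hw ⊢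
          refine ⟨hCn.conj_mem _ hw.1 g, ?_⟩
          rw [← hg', ← hw.2]; group
        · intro w _ w' _ h
          exact mul_left_cancel (mul_right_cancel h)
        · intro w hw
          simp only [mem_filter, mem_univ, true_and] at hw
          refine ⟨g⁻¹ * w * g, ?_, by group⟩
          simp only [mem_filter, mem_univ, true_and]
          constructor
          · have := hCn.conj_mem _ hw.1 g⁻¹
            rwa [inv_inv] at this
          · calc g⁻¹ * w * g * (g⁻¹ * w * g) = g⁻¹ * (w * w) * g := by group
              _ = y := by rw [hw.2, ← hg']; group
      have hq' : (q : ℤ) ≠ 0 := by exact_mod_cast hq0.ne'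
      apply mul_left_cancel₀ hq'
      rw [← hr, ← hr, h4]
  have hq' : (0 : ℤ) < q := by exact_mod_cast hq0
  have he' : (2 : ℤ) ≤ e := by exact_mod_cast he2
  have heq' : (e : ℤ) < q := by exact_mod_cast heq
  have hMR' : (M : ℤ) + q * q * b = q * c := by
    rw [← hb]
    exact_mod_cast hMR.trans hc
  have hsq := hL.card_sq
  have hclt : c < q := by
    by_contra! h
    have hqc : q ∣ c := by
      obtain ⟨l, rfl⟩ := hq
      obtain ⟨n, rfl⟩ := he
      rw [← pow_mul] at hcdvd
      obtain ⟨m, -, rfl⟩ := (Nat.dvd_prime_pow Nat.prime_two).mp hcdvd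
      exact pow_dvd_pow 2 ((Nat.pow_le_pow_iff_right Nat.one_lt_two).mp h)
    have hqe : (q : ℤ) ∣ e := by
      have hqc' : (q : ℤ) ∣ c := by exact_mod_cast hqc
      rcases hsq with hsq | hsq
      · have h3 : (q : ℤ) * (c - e) = q * (q * (a + b - e)) := by
          rw [ha] at hsq; linarith
        rw [(dvd_sub_right hqc').symm, mul_left_cancel₀ hq'.ne' h3]
        exact dvd_mul_right _ _
      · have h3 : (q : ℤ) * (c + e) = q * (q * (a + b + e)) := by
          rw [ha] at hsq; linarith
        rw [← dvd_add_right hqc', mul_left_cancel₀ hq'.ne' h3]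
        exact dvd_mul_right _ _
    have hqe' : q ∣ e := by exact_mod_cast hqe
    exact absurd (Nat.le_of_dvd (by omega) hqe') (by omega)
  have hclt' : (c : ℤ) ≤ q - 1 := by
    have : (c : ℤ) < q := by exact_mod_cast hclt
    linarith
  have hNM' : (N : ℤ) ≤ M := by exact_mod_cast hNM
  have hNpos' : (1 : ℤ) ≤ N := by exact_mod_cast hNpos
  have hsq1 : (q : ℤ) * N - M = e * q * (q - 1) := by
    refine hsq.resolve_right fun hsq => ?_
    have h3' : M ≤ q * c := by
      rw [← hc]
      omega
    have h3 : (M : ℤ) ≤ q * c := by exact_mod_cast h3'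
    have h4 : (q : ℤ) * c ≤ q * (q - 1) := mul_le_mul_of_nonneg_left hclt' hq'.le
    have h5 : (2 : ℤ) * (q * (q - 1)) ≤ e * (q * (q - 1)) :=
      mul_le_mul_of_nonneg_right he' (mul_nonneg hq'.le (by linarith))
    have h6 : (0 : ℤ) < q * N := mul_pos hq' (by linarith)
    have h7 : (0 : ℤ) ≤ q * (q - 1) := mul_nonneg hq'.le (by linarith)
    linarith
  have hce : c = e := by
    have h3 : (q : ℤ) * (c - e) = q * (q * (a + b - e)) := by
      rw [ha] at hsq1; linarith
    have h4 := mul_left_cancel₀ hq'.ne' h3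
    have h5 : (c : ℤ) - e = 0 := by
      refine Int.eq_zero_of_abs_lt_dvd (Dvd.intro _ h4.symm) (abs_lt.mpr ⟨?_, ?_⟩) <;> linarith
    exact_mod_cast sub_eq_zero.mp h5
  subst hce
  have hNge : q * c ≤ N := by
    have h3 : (c * q : ℤ) * (q - 1) ≤ N * (q - 1) := by linarith
    have h4 := le_of_mul_le_mul_right h3 (by linarith)
    rw [mul_comm]
    exact_mod_cast h4
  have hinv : ∀ w ∈ C, w * w = 1 := by
    have h3 : ({g : G | g ^ 2 = 1} : Finset G) = ({g : G | g ∈ C} : Finset G) := by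
      refine Finset.eq_of_subset_of_card_le (fun g hg => ?_) ?_
      · simp only [mem_filter, mem_univ, true_and, pow_two] at hg ⊢
        exact hCmem g (hg ▸ L.one_mem)
      · rw [← hcardC, hc]
        exact hNge
    intro w hw
    have h4 : w ∈ ({g : G | g ^ 2 = 1} : Finset G) := by
      rw [h3]; exact mem_filter.mpr ⟨mem_univ _, hw⟩
    rw [← pow_two]
    exact (mem_filter.mp h4).2
  obtain ⟨x, hxC, hxL⟩ : ∃ x ∈ C, x ∉ L := by
    by_contra! h
    have h3 := Nat.le_of_dvd Nat.card_pos (Subgroup.card_dvd_of_le (show C ≤ L from h))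
    rw [hc, hL.card_eq] at h3
    nlinarith
  obtain ⟨D, -, hD⟩ := hL.card_mul_card_of_transitive ⊤ x (fun z hz => by
    obtain ⟨g, hg⟩ := isConj_iff.mp (hL.isConj_mul x hxL z hz)
    exact ⟨g, Subgroup.mem_top g, hg⟩)
  have hCx : C ≤ ⊤ ⊓ Subgroup.centralizer {x} := by
    intro w hw
    rw [top_inf_eq, Subgroup.mem_centralizer_singleton_iff]
    have h3 := hinv _ (C.mul_mem hw hxC)
    have hw' : w⁻¹ = w := inv_eq_of_mul_eq_one_left (hinv w hw)
    have hx' : x⁻¹ = x := inv_eq_of_mul_eq_one_left (hinv x hxC)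
    rw [← inv_eq_of_mul_eq_one_left h3, mul_inv_rev, hw', hx']
  have h3 := Subgroup.card_subgroup_dvd_card D
  rw [← hD, hL.card_group] at h3
  have h4 := (mul_dvd_mul_left q (Subgroup.card_dvd_of_le hCx)).trans h3
  rw [hc, show q * (q * c) = (q * c) * q by ring,
    show c ^ 2 * q * (q - 1) = (q * c) * (c * (q - 1)) by ring] at h4
  exact hL.not_dvd (Nat.dvd_of_mul_dvd_mul_left (Nat.mul_pos hq0 (by omega)) h4)

end IsCaminaKernel
end LargeDegree

/-- If a finite group `G` has order `d(d+e)` where `d` is the degree of an irreducible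
character of `G` and `e ≥ 2`, then `|G| ≤ e⁴ - e³`. -/
theorem large_degree_bound (G : Type) [Group G] [Finite G] (d e : ℕ) (he : 2 ≤ e)
    (hcard : Nat.card G = d * (d + e))
    (hχ : ∃ χ : G → ℂ, IsIrrChar G χ ∧ χ 1 = (d : ℂ)) :
    Nat.card G ≤ e ^ 4 - e ^ 3 := by
  have := Fintype.ofFinite G
  obtain ⟨χ, hχ, hd⟩ := hχ
  have hpow : e ^ 4 - e ^ 3 = (e ^ 2 - e) * e ^ 2 := by
    rw [Nat.sub_mul]; ring_nf
  have he2 : e + e ≤ e ^ 2 := by nlinarith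
  rcases Nat.lt_or_ge (e ^ 2 - e) d with hlt | hle
  · exfalso
    have hdpos : 1 < d := by omega
    have hed : d * (d + e) < d * (d + d) := Nat.mul_lt_mul_of_pos_left (by omega) (by omega)
    have hcard' : Fintype.card G = d * (d + e) := by rw [← Nat.card_eq_fintype_card, hcard]
    obtain ⟨f, hf⟩ := LargeDegree.exists_isIntChar hχ hd (by rw [hcard']; linarith)
    obtain ⟨L, q, -, hL⟩ := hf.exists_isCaminaKernel hdpos he
      (by rw [hcard']; push_cast; ring) (by omega)
    obtain ⟨p, hp, hexp, hpow, -⟩ := hL.exists_prime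
    obtain ⟨n, hn⟩ := hL.exists_eq_pow hp hpow
    rcases hp.eq_two_or_odd' with rfl | hodd
    · exact hL.not_two_pow (fun z hz => by rw [← sq, hexp z hz]) hpow ⟨n, hn⟩
    · obtain ⟨l, rfl⟩ := hpow
      exact hL.not_odd (hn ▸ hodd.pow) hodd.pow
  · rw [hcard, hpow]
    exact Nat.mul_le_mul hle (by omega)
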